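/- Let Ω ⊆ ℝ³ be a domain convex in the directions of the lines L₁ and L₂, and assume that at least one number in each of the pairs (a₁, b₁) and (a₂, b₂) lies in ℂ∖ℝ. A mapping Ψ : Ω_ζ → ℍ(ℂ) is simultaneously right-G-monogenic and left-G-monogenic in Ω_ζ if and only if it has the form Ψ(ζ) = F₁(ξ₁)e₁ + F₂(ξ₂)e₂ + c₃e₃ + c₄e₄, where F₁ is analytic on D₁, F₂ is analytic on D₂, and c₃, c₄ ∈ ℂ are constants. -/

import Mathlib

open Filter Set Topology Quaternion

noncomputable section

abbrev HC : Type := ℍ[ℂ, -1, -1]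

/-- The idempotent `e₁ = (1 + iI)/2`. -/
def e1 : HC := ⟨1/2, Complex.I/2, 0, 0⟩
/-- The idempotent `e₂ = (1 - iI)/2`. -/
def e2 : HC := ⟨1/2, -(Complex.I/2), 0, 0⟩
/-- `e₃ = (iJ - K)/2`. -/
def e3 : HC := ⟨0, 0, Complex.I/2, -(1/2)⟩
/-- `e₄ = (iJ + K)/2`. -/
def e4 : HC := ⟨0, 0, Complex.I/2, 1/2⟩

/-- Topology on `ℍ(ℂ)` induced from the four complex coordinates. -/
instance : TopologicalSpace HC :=
  TopologicalSpace.induced (fun q : HC => (q.re, q.imI, q.imJ, q.imK)) inferInstance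

/-- Coordinate of `a ∈ ℍ(ℂ)` at `e₁` in the basis `{e₁, e₂, e₃, e₄}`. -/
def c1 (a : HC) : ℂ := a.re - Complex.I * a.imI
/-- Coordinate at `e₂`. -/
def c2 (a : HC) : ℂ := a.re + Complex.I * a.imI
/-- Coordinate at `e₃`. -/
def c3 (a : HC) : ℂ := -(Complex.I * a.imJ) - a.imK
/-- Coordinate at `e₄`. -/
def c4 (a : HC) : ℂ := -(Complex.I * a.imJ) + a.imK

/-- The norm `‖a‖ = √(|a₁|² + |a₂|² + |a₃|² + |a₄|²)`, coordinates in the basis `{e₁,e₂,e₃,e₄}`. -/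
def qnorm (a : HC) : ℝ :=
  Real.sqrt (‖c1 a‖ ^ 2 + ‖c2 a‖ ^ 2 +
    ‖c3 a‖ ^ 2 + ‖c4 a‖ ^ 2)

/-- `f₁ : ℍ(ℂ) → ℂ`, the ℂ-linear functional with `f₁(e₁) = f₁(e₃) = 1`, `f₁(e₂) = f₁(e₄) = 0`. -/
def f1 (a : HC) : ℂ := c1 a + c3 a
/-- `f₂ : ℍ(ℂ) → ℂ`, with `f₂(e₂) = f₂(e₄) = 1`, `f₂(e₁) = f₂(e₃) = 0`. -/
def f2 (a : HC) : ℂ := c2 a + c4 a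
/-- `f̂₁ : ℍ(ℂ) → ℂ`, with `f̂₁(e₁) = f̂₁(e₄) = 1`, `f̂₁(e₂) = f̂₁(e₃) = 0`. -/
def fh1 (a : HC) : ℂ := c1 a + c4 a
/-- `f̂₂ : ℍ(ℂ) → ℂ`, with `f̂₂(e₂) = f̂₂(e₃) = 1`, `f̂₂(e₁) = f̂₂(e₄) = 0`. -/
def fh2 (a : HC) : ℂ := c2 a + c3 a

/-- `ζ = x i₁ + y i₂ + z i₃` for `p = (x, y, z) ∈ ℝ³` (with `i₁ = 1`). -/
def zeta (i2 i3 : HC) (p : ℝ × ℝ × ℝ) : HC :=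
  (p.1 : ℂ) • (1 : HC) + (p.2.1 : ℂ) • i2 + (p.2.2 : ℂ) • i3

/-- The real linear span `E₃` of `i₁ = 1, i₂, i₃`. -/
def E3 (i2 i3 : HC) : Set HC := Set.range (zeta i2 i3)

/-- `i₁ = 1, i₂, i₃` are linearly independent over `ℝ`. -/
def LinIndep (i2 i3 : HC) : Prop :=
  ∀ α₁ α₂ α₃ : ℝ, (α₁ : ℂ) • (1 : HC) + (α₂ : ℂ) • i2 + (α₃ : ℂ) • i3 = 0 →
    α₁ = 0 ∧ α₂ = 0 ∧ α₃ = 0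

/-- `Φ` is right-G-monogenic on `S` (w.r.t. directions in `E₃`): it is continuous on `S` and at
every `ζ ∈ S` there is `Φ'(ζ)` with `lim_{ε→0+} (Φ(ζ+εh) − Φ(ζ))ε⁻¹ = h·Φ'(ζ)` for all `h ∈ E₃`. -/
def RightGMonogenic (i2 i3 : HC) (Φ : HC → HC) (S : Set HC) : Prop :=
  ContinuousOn Φ S ∧ ∀ ζ ∈ S, ∃ Φ' : HC, ∀ h ∈ E3 i2 i3,
    Tendsto (fun ε : ℝ => ((ε : ℂ))⁻¹ • (Φ (ζ + (ε : ℂ) • h) - Φ ζ))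
      (nhdsWithin 0 (Set.Ioi 0)) (nhds (h * Φ'))

/-- `Φ̂` is left-G-monogenic on `S`. -/
def LeftGMonogenic (i2 i3 : HC) (Φ : HC → HC) (S : Set HC) : Prop :=
  ContinuousOn Φ S ∧ ∀ ζ ∈ S, ∃ Φ' : HC, ∀ h ∈ E3 i2 i3,
    Tendsto (fun ε : ℝ => ((ε : ℂ))⁻¹ • (Φ (ζ + (ε : ℂ) • h) - Φ ζ))
      (nhdsWithin 0 (Set.Ioi 0)) (nhds (Φ' * h))

/-- The right maximal ideal `𝓘₁ = {λ₂e₂ + λ₄e₄}`. -/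
def I1 : Set HC := {a | ∃ l2 l4 : ℂ, a = l2 • e2 + l4 • e4}
/-- The right maximal ideal `𝓘₂ = {λ₁e₁ + λ₃e₃}`. -/
def I2 : Set HC := {a | ∃ l1 l3 : ℂ, a = l1 • e1 + l3 • e3}
/-- The left maximal ideal `𝓘̂₁ = {λ₂e₂ + λ₃e₃}`. -/
def Ih1 : Set HC := {a | ∃ l2 l3 : ℂ, a = l2 • e2 + l3 • e3}
/-- The left maximal ideal `𝓘̂₂ = {λ₁e₁ + λ₄e₄}`. -/
def Ih2 : Set HC := {a | ∃ l1 l4 : ℂ, a = l1 • e1 + l4 • e4}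

/-- The line `L` in `ℝ³` given by `x + y·Re a + z·Re b = 0`, `y·Im a + z·Im b = 0`. -/
def lineL (a b : ℂ) : Set (ℝ × ℝ × ℝ) :=
  {p | p.1 + p.2.1 * a.re + p.2.2 * b.re = 0 ∧ p.2.1 * a.im + p.2.2 * b.im = 0}

/-- `Ω` is convex in the direction of the line `L` (a line through the origin): it contains every
segment parallel to `L` joining two of its points. -/
def ConvexInDirection (Ω : Set (ℝ × ℝ × ℝ)) (L : Set (ℝ × ℝ × ℝ)) : Prop :=
  ∀ p ∈ Ω, ∀ q ∈ Ω, q - p ∈ L → segment ℝ p q ⊆ Ω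

/-- `ξ = x + y·a + z·b` for `p = (x,y,z)`. -/
def xi (a b : ℂ) (p : ℝ × ℝ × ℝ) : ℂ := (p.1 : ℂ) + (p.2.1 : ℂ) * a + (p.2.2 : ℂ) * b


/-- `Φ'` is a right Gateaux derivative of `Φ` on `S` (directions in `E₃`). -/
def IsRightGDeriv (i2 i3 : HC) (Φ Φ' : HC → HC) (S : Set HC) : Prop :=
  ∀ ζ ∈ S, ∀ h ∈ E3 i2 i3,
    Tendsto (fun ε : ℝ => ((ε : ℂ))⁻¹ • (Φ (ζ + (ε : ℂ) • h) - Φ ζ))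
      (nhdsWithin 0 (Set.Ioi 0)) (nhds (h * Φ' ζ))

/-- `Φ'` is a left Gateaux derivative of `Φ` on `S`. -/
def IsLeftGDeriv (i2 i3 : HC) (Φ Φ' : HC → HC) (S : Set HC) : Prop :=
  ∀ ζ ∈ S, ∀ h ∈ E3 i2 i3,
    Tendsto (fun ε : ℝ => ((ε : ℂ))⁻¹ • (Φ (ζ + (ε : ℂ) • h) - Φ ζ))
      (nhdsWithin 0 (Set.Ioi 0)) (nhds (Φ' ζ * h))

/-- Triples `(α, β, γ)` of naturals with `α + β + γ = n`. -/
def trip (n : ℕ) : Finset (ℕ × ℕ × ℕ) :=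
  (Finset.range (n + 1) ×ˢ Finset.range (n + 1) ×ˢ Finset.range (n + 1)).filter
    (fun u => u.1 + u.2.1 + u.2.2 = n)


open MeasureTheory in
lemma lineA_real (U d : ℝ → ℝ) (K : Set ℝ) (a b L : ℝ) (hab : a ≤ b) (hL : 0 ≤ L)
    (hK : IsClosed K) (hKne : K.Nonempty) (hKab : K ⊆ Icc a b)
    (hlip : ∀ x ∈ K, ∀ t ∈ Icc a b, |U t - U x| ≤ L * |t - x|)
    (hd : ∀ x ∈ K, HasDerivAt U (d x) x) :
    |U b - U a - ∫ x in K, d x| ≤ 3 * L * (volume.real (Ioc a b \ K)) := by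
  have hKc : IsCompact K := isCompact_Icc.of_isClosed_subset hK hKab
  have hLon : LipschitzOnWith ⟨L, hL⟩ U K := by
    apply LipschitzOnWith.of_dist_le_mul
    intro x hx y hy
    rw [Real.dist_eq, Real.dist_eq]
    exact hlip y hy x (hKab hx)
  obtain ⟨g, hg, hgU⟩ := hLon.extend_real
  have hgl : ∀ x y, |g x - g y| ≤ L * |x - y| := by
    intro x y
    have := hg.dist_le_mul x y
    rw [Real.dist_eq, Real.dist_eq] at this
    exact this
  have hgd : ∀ x, ‖deriv g x‖ ≤ L := fun x => norm_deriv_le_of_lipschitz hg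
  have hac : AbsolutelyContinuousOnInterval g a b :=
    (hg.lipschitzOnWith (s := uIcc a b)).absolutelyContinuousOnInterval
  have hftc := hac.integral_deriv_eq_sub
  have hintg := hac.intervalIntegrable_deriv
  rw [intervalIntegral.integral_of_le hab] at hftc
  rw [intervalIntegrable_iff_integrableOn_Ioc_of_le hab] at hintg
  have hae : ∀ᵐ x ∂(volume.restrict K), d x = deriv g x := by
    rw [ae_restrict_iff' hK.measurableSet]
    have h1 : ∀ᵐ x, DifferentiableAt ℝ g x := hg.ae_differentiableAt
    have h2 : ∀ᵐ x ∂(volume : Measure ℝ), x ∉ { x ∈ K | 𝓝[K ∩ Ioi x] x = ⊥ } :=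
      (countable_setOfPred_isolated_right_within (s := K)).ae_notMem _
    filter_upwards [h1, h2] with x hx1 hx2 hxK
    have hne : (𝓝[K ∩ Ioi x] x).NeBot := by
      rw [neBot_iff]
      intro h
      exact hx2 ⟨hxK, h⟩
    have e1 : HasDerivWithinAt U (d x) (K ∩ Ioi x) x := (hd x hxK).hasDerivWithinAt
    have e2 : HasDerivWithinAt U (deriv g x) (K ∩ Ioi x) x := by
      apply (hx1.hasDerivAt.hasDerivWithinAt (s := K ∩ Ioi x)).congr
      · intro y hy; exact hgU hy.1
      · exact hgU hxK
    rw [hasDerivWithinAt_iff_tendsto_slope' (by simp)] at e1 e2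
    exact tendsto_nhds_unique e1 e2
  have hKI : (K ∩ Ioc a b : Set ℝ) =ᵐ[volume] K := by
    have : (K ∩ Ioc a b : Set ℝ) =ᵐ[volume] (K ∩ Icc a b : Set ℝ) :=
      (ae_eq_refl K).inter Ioc_ae_eq_Icc
    rwa [inter_eq_left.2 hKab] at this
  have hsplit : ∫ x in Ioc a b, deriv g x = (∫ x in K, d x) + ∫ x in Ioc a b \ K, deriv g x := by
    rw [integral_congr_ae hae, ← setIntegral_congr_set hKI, inter_comm]
    exact (integral_inter_add_sdiff hK.measurableSet hintg).symm
  have hrest : |∫ x in Ioc a b \ K, deriv g x| ≤ L * volume.real (Ioc a b \ K) := by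
    rw [← Real.norm_eq_abs]
    apply norm_setIntegral_le_of_norm_le_const
    · exact lt_of_le_of_lt (measure_mono sdiff_subset) (by simp)
    · intro x _; exact hgd x
  have hfin : volume (Ioc a b \ K) ≠ ⊤ :=
    (lt_of_le_of_lt (measure_mono sdiff_subset) (by simp : volume (Ioc a b) < ⊤)).ne
  have kM := hKc.sSup_mem hKne
  have km := hKc.sInf_mem hKne
  set M := sSup K with hM
  set m := sInf K with hm
  have hMub : ∀ x ∈ K, x ≤ M := fun x hx => le_csSup hKc.bddAbove hx
  have hmlb : ∀ x ∈ K, m ≤ x := fun x hx => csInf_le hKc.bddBelow hx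
  have hmM : m ≤ M := hMub m km
  have hbM : |U b - g b| ≤ 2 * L * (b - M) := by
    have h1 := hlip M kM b ⟨hab, le_rfl⟩
    have h2 := hgl M b
    have h3 := hgU kM
    have h4 : |b - M| = b - M := abs_of_nonneg (by linarith [(hKab kM).2])
    rw [abs_sub_comm M b, h4] at h2
    rw [h4] at h1
    rw [h3] at h1
    rw [abs_le] at *
    constructor <;> linarith
  have ham : |U a - g a| ≤ 2 * L * (m - a) := by
    have h1 := hlip m km a ⟨le_rfl, hab⟩
    have h2 := hgl m a
    have h3 := hgU km
    have h4 : |m - a| = m - a := abs_of_nonneg (by linarith [(hKab km).1])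
    rw [h4] at h2
    rw [abs_sub_comm a m, h4] at h1
    rw [h3] at h1
    rw [abs_le] at *
    constructor <;> linarith
  have hmeas : (b - M) + (m - a) ≤ volume.real (Ioc a b \ K) := by
    have hsub : Ioc M b ∪ Ioo a m ⊆ Ioc a b \ K := by
      rintro x (hx | hx)
      · exact ⟨⟨lt_of_le_of_lt (hKab kM).1 hx.1, hx.2⟩, fun h => absurd (hMub x h) (not_le.2 hx.1)⟩
      · exact ⟨⟨hx.1, hx.2.le.trans (hKab km).2⟩, fun h => absurd (hmlb x h) (not_le.2 hx.2)⟩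
    have hdis : Disjoint (Ioc M b) (Ioo a m) := by
      rw [Set.disjoint_left]
      intro x hx hy
      linarith [hx.1, hy.2]
    have := measureReal_mono hsub hfin
    rw [measureReal_union hdis measurableSet_Ioo (by simp) (by simp)] at this
    simpa [Real.volume_real_Ioc_of_le (hKab kM).2, Real.volume_real_Ioo_of_le (hKab km).1]
      using this
  have hfinal : U b - U a - ∫ x in K, d x = (U b - g b) - (U a - g a)
      + ∫ x in Ioc a b \ K, deriv g x := by linarith
  rw [hfinal]
  have t1 := abs_add_le ((U b - g b) - (U a - g a)) (∫ x in Ioc a b \ K, deriv g x)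
  have t2 := abs_sub (U b - g b) (U a - g a)
  nlinarith [mul_le_mul_of_nonneg_left hmeas hL]

open MeasureTheory in
lemma lineA (U d : ℝ → ℂ) (K : Set ℝ) (a b L : ℝ) (hab : a ≤ b) (hL : 0 ≤ L)
    (hK : IsClosed K) (hKne : K.Nonempty) (hKab : K ⊆ Icc a b)
    (hlip : ∀ x ∈ K, ∀ t ∈ Icc a b, ‖U t - U x‖ ≤ L * |t - x|)
    (hd : ∀ x ∈ K, HasDerivAt U (d x) x) (hdi : IntegrableOn d K) :
    ‖U b - U a - ∫ x in K, d x‖ ≤ 6 * L * (volume.real (Ioc a b \ K)) := by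
  have h1 := lineA_real (fun t => (U t).re) (fun t => (d t).re) K a b L hab hL hK hKne hKab
    (fun x hx t ht => (by
      have := Complex.abs_re_le_norm (U t - U x)
      rw [Complex.sub_re] at this
      exact this.trans (hlip x hx t ht)))
    (fun x hx => (by
      have := (Complex.reCLM.hasFDerivAt.comp_hasDerivAt x (hd x hx))
      exact this))
  have h2 := lineA_real (fun t => (U t).im) (fun t => (d t).im) K a b L hab hL hK hKne hKab
    (fun x hx t ht => (by
      have := Complex.abs_im_le_norm (U t - U x)
      rw [Complex.sub_im] at this
      exact this.trans (hlip x hx t ht)))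
    (fun x hx => (by
      have := (Complex.imCLM.hasFDerivAt.comp_hasDerivAt x (hd x hx))
      exact this))
  have e1 : ∫ x in K, (d x).re = (∫ x in K, d x).re := by
    exact integral_re hdi
  have e2 : ∫ x in K, (d x).im = (∫ x in K, d x).im := by
    exact integral_im hdi
  have := Complex.norm_le_abs_re_add_abs_im (U b - U a - ∫ x in K, d x)
  simp only [Complex.sub_re, Complex.sub_im, ← e1, ← e2] at this
  linarith

open MeasureTheory in
lemma rectB (F : ℝ → ℝ → ℂ) (D : ℝ × ℝ → ℂ) (K : Set (ℝ × ℝ)) (a b c d a0 b0 c0 d0 L C : ℝ)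
    (hab : a ≤ b) (hcd : c ≤ d) (hL : 0 ≤ L) (ha : a0 ≤ a) (hb : b ≤ b0) (hc : c0 ≤ c) (hd : d ≤ d0)
    (hK : IsClosed K) (hKR : K ⊆ Icc a b ×ˢ Icc c d)
    (hlip : ∀ p ∈ K, ∀ t ∈ Icc a b, ‖F t p.2 - F p.1 p.2‖ ≤ L * |t - p.1|)
    (hder : ∀ p ∈ K, HasDerivAt (fun t => F t p.2) (D p) p.1)
    (hDi : IntegrableOn D K)
    (hC1 : 6 * L ≤ C) (hmiss : ∀ y ∈ Icc c d, ‖F b y - F a y‖ ≤ C * (b0 - a0))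
    (hca : ContinuousOn (fun y => F a y) (Icc c d)) (hcb : ContinuousOn (fun y => F b y) (Icc c d)) :
    ‖((∫ y in c..d, F b y) - ∫ y in c..d, F a y) - ∫ p in K, D p‖
      ≤ C * volume.real ((Ioc a0 b0 ×ˢ Ioc c0 d0) \ K) := by
  set Q : Set (ℝ × ℝ) := (Ioc a0 b0 ×ˢ Ioc c0 d0) \ K with hQ
  have hQm : MeasurableSet Q :=
    (measurableSet_Ioc.prod measurableSet_Ioc).diff hK.measurableSet
  have hQf : volume Q < ⊤ := by
    refine lt_of_le_of_lt (measure_mono sdiff_subset) ?_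
    rw [Measure.volume_eq_prod, Measure.prod_prod]
    simp [ENNReal.mul_lt_top]
  have hQi : Integrable (Q.indicator (fun _ => (1 : ℝ))) (volume.prod volume) := by
    rw [integrable_indicator_iff hQm]
    rw [← Measure.volume_eq_prod]
    exact integrableOn_const hQf.ne
  set M : ℝ → ℝ := fun y => ∫ x, Q.indicator (fun _ => (1 : ℝ)) (x, y) with hMdef
  have hMi : Integrable M := hQi.integral_prod_right
  have hMint : ∫ y, M y = volume.real Q := by
    rw [hMdef, ← integral_prod_symm _ hQi, ← Measure.volume_eq_prod, integral_indicator hQm]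
    simp
  have hsec : ∀ y, MeasurableSet {x | (x, y) ∈ Q} := fun y => measurable_prodMk_right hQm
  have hMy : ∀ y, M y = volume.real {x | (x, y) ∈ Q} := by
    intro y
    have : (fun x => Q.indicator (fun _ => (1 : ℝ)) (x, y))
        = ({x | (x, y) ∈ Q}).indicator (fun _ => (1 : ℝ)) := by
      ext x; simp [indicator]
    rw [hMdef]; simp only [this]
    rw [integral_indicator (hsec y)]
    simp
  have hMnn : ∀ y, 0 ≤ M y := fun y => by rw [hMy]; exact measureReal_nonneg
  have hDi' : Integrable (K.indicator D) (volume.prod volume) := by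
    rw [integrable_indicator_iff hK.measurableSet, ← Measure.volume_eq_prod]
    exact hDi
  set T : ℝ → ℂ := fun y => ∫ x, K.indicator D (x, y) with hT
  have hTi : Integrable T := hDi'.integral_prod_right
  have hKy : ∀ y, IsClosed {x | (x, y) ∈ K} := fun y =>
    hK.preimage (Continuous.prodMk_left y)
  have hKD : ∀ y, (fun x => K.indicator D (x, y))
      = ({x | (x, y) ∈ K}).indicator (fun x => D (x, y)) := by
    intro y; ext x; simp [indicator]
  have hTy : ∀ y, T y = ∫ x in {x | (x, y) ∈ K}, D (x, y) := by
    intro y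
    rw [hT]; simp only [hKD]
    rw [integral_indicator (hKy y).measurableSet]
  have hTint : ∫ p in K, D p = ∫ y in Icc c d, T y := by
    rw [← integral_indicator hK.measurableSet, Measure.volume_eq_prod, integral_prod_symm _ hDi']
    symm
    apply setIntegral_eq_integral_of_forall_compl_eq_zero
    intro y hy
    rw [hTy]
    have : {x | (x, y) ∈ K} = ∅ := by
      ext x
      simp only [mem_ofPred_eq, mem_empty_iff_false, iff_false]
      intro h
      exact hy (hKR h).2
    rw [this]; simp
  have hsecint : ∀ᵐ y, Integrable (fun x => K.indicator D (x, y)) := hDi'.prod_left_ae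
  rw [hTint, integral_Icc_eq_integral_Ioc, intervalIntegral.integral_of_le hcd,
    intervalIntegral.integral_of_le hcd]
  have ia : IntegrableOn (fun y => F a y) (Ioc c d) :=
    (hca.integrableOn_Icc).mono_set Ioc_subset_Icc_self
  have ib : IntegrableOn (fun y => F b y) (Ioc c d) :=
    (hcb.integrableOn_Icc).mono_set Ioc_subset_Icc_self
  have iab : IntegrableOn (fun y => F b y - F a y) (Ioc c d) := ib.sub ia
  rw [← integral_sub ib ia, ← integral_sub iab hTi.integrableOn]
  have hCnn : 0 ≤ C := by linarith
  have hbound : ∀ᵐ y ∂(volume.restrict (Ioc c d)), ‖F b y - F a y - T y‖ ≤ C * M y := by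
    rw [ae_restrict_iff' measurableSet_Ioc]
    filter_upwards [hsecint] with y hy hyI
    have hyI' : y ∈ Icc c d := Ioc_subset_Icc_self hyI
    have hy0 : y ∈ Ioc c0 d0 := ⟨lt_of_le_of_lt hc hyI.1, hyI.2.trans hd⟩
    have hset : {x | (x, y) ∈ Q} = Ioc a0 b0 \ {x | (x, y) ∈ K} := by
      ext x
      simp only [hQ, mem_ofPred_eq, Set.mem_sdiff, mem_prod, hy0, and_true]
    rw [hMy, hset]
    by_cases hne : ({x | (x, y) ∈ K}).Nonempty
    · rw [hTy]
      rw [hKD, integrable_indicator_iff (hKy y).measurableSet] at hy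
      have := lineA (fun x => F x y) (fun x => D (x, y)) {x | (x, y) ∈ K} a b L hab hL (hKy y) hne
        (fun x hx => (hKR hx).1) (fun x hx t ht => hlip (x, y) hx t ht)
        (fun x hx => hder (x, y) hx) hy
      refine this.trans ?_
      have hmono : volume.real (Ioc a b \ {x | (x, y) ∈ K})
          ≤ volume.real (Ioc a0 b0 \ {x | (x, y) ∈ K}) := by
        apply measureReal_mono
        · exact sdiff_subset_sdiff_left (Ioc_subset_Ioc ha hb)
        · exact (lt_of_le_of_lt (measure_mono sdiff_subset) (by simp : volume (Ioc a0 b0) < ⊤)).ne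
      exact mul_le_mul hC1 hmono measureReal_nonneg hCnn
    · rw [not_nonempty_iff_eq_empty] at hne
      rw [hTy, hne]
      simp only [Measure.restrict_empty, integral_zero_measure, sub_zero, sdiff_empty]
      rw [Real.volume_real_Ioc_of_le (by linarith)]
      exact hmiss y hyI'
  calc ‖∫ y in Ioc c d, (F b y - F a y - T y)‖
      ≤ ∫ y in Ioc c d, C * M y :=
        norm_integral_le_of_norm_le (hMi.const_mul C).integrableOn hbound
    _ = C * ∫ y in Ioc c d, M y := by rw [integral_const_mul]
    _ ≤ C * ∫ y, M y := by
        apply mul_le_mul_of_nonneg_left _ hCnn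
        exact setIntegral_le_integral hMi (Eventually.of_forall hMnn)
    _ = _ := by rw [hMint]

lemma missB (F : ℝ → ℝ → ℂ) (a b c d L w h ya yb : ℝ) (hL : 0 ≤ L)
    (hab : a ≤ b) (hw : b - a ≤ w) (hh : d - c ≤ h)
    (hya : ya ∈ Icc c d) (hyb : yb ∈ Icc c d)
    (h1 : ∀ t ∈ Icc a b, ‖F t yb - F b yb‖ ≤ L * |t - b|)
    (h2 : ∀ t ∈ Icc c d, ‖F b t - F b yb‖ ≤ L * |t - yb|)
    (h3 : ∀ t ∈ Icc c d, ‖F a t - F a ya‖ ≤ L * |t - ya|) :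
    ∀ y ∈ Icc c d, ‖F b y - F a y‖ ≤ L * (3 * h + w) := by
  intro y hy
  have e1 := h2 y hy
  have e2 := h3 y hy
  have e3 := h3 yb hyb
  have e4 := h1 a ⟨le_rfl, hab⟩
  have b1 : |y - yb| ≤ h := by rw [abs_le]; constructor <;> linarith [hy.1, hy.2, hyb.1, hyb.2]
  have b2 : |y - ya| ≤ h := by rw [abs_le]; constructor <;> linarith [hy.1, hy.2, hya.1, hya.2]
  have b3 : |yb - ya| ≤ h := by
    rw [abs_le]; constructor <;> linarith [hyb.1, hyb.2, hya.1, hya.2]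
  have b4 : |a - b| ≤ w := by rw [abs_le]; constructor <;> linarith
  have key : F b y - F a y = (F b y - F b yb) - (F a yb - F b yb) + (F a yb - F a ya)
      - (F a y - F a ya) := by ring
  rw [key]
  have n1 := norm_sub_le ((F b y - F b yb) - (F a yb - F b yb) + (F a yb - F a ya)) (F a y - F a ya)
  have n2 := norm_add_le ((F b y - F b yb) - (F a yb - F b yb)) (F a yb - F a ya)
  have n3 := norm_sub_le (F b y - F b yb) (F a yb - F b yb)
  have m1 := mul_le_mul_of_nonneg_left b1 hL
  have m2 := mul_le_mul_of_nonneg_left b2 hL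
  have m3 := mul_le_mul_of_nonneg_left b3 hL
  have m4 := mul_le_mul_of_nonneg_left b4 hL
  nlinarith

/-- integral over the boundary of a rectangle -/
def rI (f : ℂ → ℂ) (a b c d : ℝ) : ℂ :=
  (∫ x in a..b, f (x + c * Complex.I)) - (∫ x in a..b, f (x + d * Complex.I))
    + Complex.I * (∫ y in c..d, f (b + y * Complex.I))
    - Complex.I * (∫ y in c..d, f (a + y * Complex.I))

lemma rI_zero (f : ℂ → ℂ) (a b c d : ℝ) (hab : a ≤ b) (hcd : c ≤ d)
    (hc : ∀ x ∈ Icc a b, ∀ y ∈ Icc c d, ContinuousWithinAt f (Icc a b ×ℂ Icc c d)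
      (x + y * Complex.I))
    (hd : ∀ x ∈ Ioo a b, ∀ y ∈ Ioo c d, DifferentiableAt ℂ f (x + y * Complex.I)) :
    rI f a b c d = 0 := by
  have := Complex.integral_boundary_rect_eq_zero_of_continuousOn_of_differentiableOn f
    (a + c * Complex.I) (b + d * Complex.I) (by
      simp only [Complex.add_re, Complex.ofReal_re, Complex.mul_re, Complex.I_re, mul_zero,
        Complex.ofReal_im, Complex.I_im, mul_one, sub_self, add_zero, Complex.add_im,
        Complex.mul_im, zero_add, uIcc_of_le hab, uIcc_of_le hcd]
      intro z hz
      rw [Complex.mem_reProdIm] at hz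
      have := hc z.re hz.1 z.im hz.2
      rwa [Complex.re_add_im] at this) (by
      simp only [Complex.add_re, Complex.ofReal_re, Complex.mul_re, Complex.I_re, mul_zero,
        Complex.ofReal_im, Complex.I_im, mul_one, sub_self, add_zero, Complex.add_im,
        Complex.mul_im, zero_add, min_eq_left hab, min_eq_left hcd, max_eq_right hab,
        max_eq_right hcd]
      intro z hz
      rw [Complex.mem_reProdIm] at hz
      have := hd z.re hz.1 z.im hz.2
      rw [Complex.re_add_im] at this
      exact this.differentiableWithinAt)
  simpa [rI] using this

lemma rI_split_x (f : ℂ → ℂ) (A B C D a m b c d : ℝ) (hf : ContinuousOn f (Icc A B ×ℂ Icc C D))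
    (ha : a ∈ Icc A B) (hm : m ∈ Icc A B) (hb : b ∈ Icc A B) (hc : c ∈ Icc C D) (hd : d ∈ Icc C D) :
    rI f a b c d = rI f a m c d + rI f m b c d := by
  have key : ∀ c ∈ Icc C D, ∀ a ∈ Icc A B, ∀ b ∈ Icc A B,
      IntervalIntegrable (fun x : ℝ => f (x + c * Complex.I)) MeasureTheory.volume a b := by
    intro c hc a ha b hb
    apply ContinuousOn.intervalIntegrable
    apply hf.comp (by fun_prop)
    intro x hx
    rw [Complex.mem_reProdIm]
    simp only [Complex.add_re, Complex.ofReal_re, Complex.mul_re, Complex.I_re, mul_zero,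
        Complex.ofReal_im, Complex.I_im, mul_one, sub_self, add_zero, Complex.add_im,
        Complex.mul_im, zero_add]
    exact ⟨uIcc_subset_Icc ha hb hx, hc⟩
  unfold rI
  rw [← intervalIntegral.integral_add_adjacent_intervals (key c hc a ha m hm) (key c hc m hm b hb),
    ← intervalIntegral.integral_add_adjacent_intervals (key d hd a ha m hm) (key d hd m hm b hb)]
  ring

lemma rI_split_y (f : ℂ → ℂ) (A B C D a b c m d : ℝ) (hf : ContinuousOn f (Icc A B ×ℂ Icc C D))
    (ha : a ∈ Icc A B) (hb : b ∈ Icc A B) (hc : c ∈ Icc C D) (hm : m ∈ Icc C D) (hd : d ∈ Icc C D) :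
    rI f a b c d = rI f a b c m + rI f a b m d := by
  have key : ∀ a ∈ Icc A B, ∀ c ∈ Icc C D, ∀ d ∈ Icc C D,
      IntervalIntegrable (fun y : ℝ => f (a + y * Complex.I)) MeasureTheory.volume c d := by
    intro a ha c hc d hd
    apply ContinuousOn.intervalIntegrable
    apply hf.comp (by fun_prop)
    intro x hx
    rw [Complex.mem_reProdIm]
    simp only [Complex.add_re, Complex.ofReal_re, Complex.mul_re, Complex.I_re, mul_zero,
        Complex.ofReal_im, Complex.I_im, mul_one, sub_self, add_zero, Complex.add_im,
        Complex.mul_im, zero_add]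
    exact ⟨ha, uIcc_subset_Icc hc hd hx⟩
  unfold rI
  rw [← intervalIntegral.integral_add_adjacent_intervals (key a ha c hc m hm) (key a ha m hm d hd),
    ← intervalIntegral.integral_add_adjacent_intervals (key b hb c hc m hm) (key b hb m hm d hd)]
  ring

/-- Local data for the Looman-Menchoff argument. -/
structure LMData (f : ℂ → ℂ) (G : ℝ × ℝ → ℂ) (K : Set (ℝ × ℝ)) (A B C D L : ℝ) : Prop where
  cont : ContinuousOn f (Icc A B ×ℂ Icc C D)
  closed : IsClosed K
  sub : K ⊆ Icc A B ×ˢ Icc C D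
  diff : ∀ x ∈ Icc A B, ∀ y ∈ Icc C D, (x, y) ∉ K → DifferentiableAt ℂ f (x + y * Complex.I)
  L0 : 0 ≤ L
  lipx : ∀ p ∈ K, ∀ t ∈ Icc A B,
    ‖f (t + p.2 * Complex.I) - f (p.1 + p.2 * Complex.I)‖ ≤ L * |t - p.1|
  lipy : ∀ p ∈ K, ∀ t ∈ Icc C D,
    ‖f (p.1 + t * Complex.I) - f (p.1 + p.2 * Complex.I)‖ ≤ L * |t - p.2|
  derx : ∀ p ∈ K, HasDerivAt (fun t : ℝ => f (t + p.2 * Complex.I)) (G p) p.1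
  dery : ∀ p ∈ K, HasDerivAt (fun t : ℝ => f (p.1 + t * Complex.I)) (Complex.I * G p) p.2
  int : MeasureTheory.IntegrableOn G K

lemma LMData.rI_zero' {f : ℂ → ℂ} {G : ℝ × ℝ → ℂ} {K : Set (ℝ × ℝ)} {A B C D L : ℝ}
    (H : LMData f G K A B C D L) (a b c d : ℝ) (hA : A ≤ a) (hab : a ≤ b) (hB : b ≤ B)
    (hC : C ≤ c) (hcd : c ≤ d) (hD : d ≤ D)
    (hK : ∀ x ∈ Ioo a b, ∀ y ∈ Ioo c d, (x, y) ∉ K) : rI f a b c d = 0 := by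
  apply rI_zero f a b c d hab hcd
  · intro x hx y hy
    have hc := H.cont.mono (Complex.reProdIm_subset_iff'.2 (Or.inl
      ⟨Icc_subset_Icc hA hB, Icc_subset_Icc hC hD⟩) : Icc a b ×ℂ Icc c d ⊆ Icc A B ×ℂ Icc C D)
    apply hc
    rw [Complex.mem_reProdIm]
    simpa using ⟨hx, hy⟩
  · intro x hx y hy
    exact H.diff x ⟨hA.trans hx.1.le, hx.2.le.trans hB⟩ y ⟨hC.trans hy.1.le, hy.2.le.trans hD⟩
      (hK x hx y hy)

open MeasureTheory in
lemma LMData.rectC {f : ℂ → ℂ} {G : ℝ × ℝ → ℂ} {K : Set (ℝ × ℝ)} {A B C D L : ℝ}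
    (H : LMData f G K A B C D L) (a b c d M : ℝ) (hA : A ≤ a) (hab : a < b) (hB : b ≤ B)
    (hC : C ≤ c) (hcd : c < d) (hD : d ≤ D) (hM1 : 6 * L ≤ M)
    (hM2 : L * (3 * (d - c) + (b - a)) ≤ M * (b - a))
    (hM3 : L * (3 * (b - a) + (d - c)) ≤ M * (d - c))
    (hne : (K ∩ Icc a b ×ˢ Icc c d).Nonempty) :
    ‖rI f a b c d‖ ≤ 2 * M * volume.real ((Ioc a b ×ˢ Ioc c d) \ K) := by
  set K' := K ∩ Icc a b ×ˢ Icc c d with hK'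
  have hK'cl : IsClosed K' := H.closed.inter (isClosed_Icc.prod isClosed_Icc)
  have hK'c : IsCompact K' := (isCompact_Icc.prod isCompact_Icc).inter_left H.closed
  obtain ⟨pa, hpa, hpa'⟩ := hK'c.exists_isMinOn hne continuous_fst.continuousOn
  obtain ⟨pb, hpb, hpb'⟩ := hK'c.exists_isMaxOn hne continuous_fst.continuousOn
  obtain ⟨pc, hpc, hpc'⟩ := hK'c.exists_isMinOn hne continuous_snd.continuousOn
  obtain ⟨pd, hpd, hpd'⟩ := hK'c.exists_isMaxOn hne continuous_snd.continuousOn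
  rw [isMinOn_iff] at hpa' hpc'
  rw [isMaxOn_iff] at hpb' hpd'
  obtain ⟨a', ya⟩ := pa
  obtain ⟨b', yb⟩ := pb
  obtain ⟨xc, c'⟩ := pc
  obtain ⟨xd, d'⟩ := pd
  simp only at hpa' hpb' hpc' hpd'
  have ra := hpa.2
  have rb := hpb.2
  have rc := hpc.2
  have rd := hpd.2
  simp only [mem_prod] at ra rb rc rd
  have hab' : a' ≤ b' := hpa' _ hpb
  have hcd' : c' ≤ d' := hpc' _ hpd
  have hyax : ya ∈ Icc c' d' := ⟨hpc' _ hpa, hpd' _ hpa⟩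
  have hybx : yb ∈ Icc c' d' := ⟨hpc' _ hpb, hpd' _ hpb⟩
  have hxcx : xc ∈ Icc a' b' := ⟨hpa' _ hpc, hpb' _ hpc⟩
  have hxdx : xd ∈ Icc a' b' := ⟨hpa' _ hpd, hpb' _ hpd⟩
  have hK'R : K' ⊆ Icc a' b' ×ˢ Icc c' d' := fun p hp =>
    ⟨⟨hpa' p hp, hpb' p hp⟩, ⟨hpc' p hp, hpd' p hp⟩⟩
  have aAB : a ∈ Icc A B := ⟨hA, hab.le.trans hB⟩
  have bAB : b ∈ Icc A B := ⟨hA.trans hab.le, hB⟩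
  have cCD : c ∈ Icc C D := ⟨hC, hcd.le.trans hD⟩
  have dCD : d ∈ Icc C D := ⟨hC.trans hcd.le, hD⟩
  have sx : ∀ x ∈ Icc a b, x ∈ Icc A B := fun x hx => ⟨hA.trans hx.1, hx.2.trans hB⟩
  have sy : ∀ x ∈ Icc c d, x ∈ Icc C D := fun x hx => ⟨hC.trans hx.1, hx.2.trans hD⟩
  have sx' : ∀ x ∈ Icc a' b', x ∈ Icc A B :=
    fun x hx => sx x ⟨ra.1.1.trans hx.1, hx.2.trans rb.1.2⟩
  have sy' : ∀ x ∈ Icc c' d', x ∈ Icc C D :=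
    fun x hx => sy x ⟨rc.2.1.trans hx.1, hx.2.trans rd.2.2⟩
  have hred : rI f a b c d = rI f a' b' c' d' := by
    rw [rI_split_x f A B C D a a' b c d H.cont aAB (sx _ ra.1) bAB cCD dCD,
      rI_split_x f A B C D a' b' b c d H.cont (sx _ ra.1) (sx _ rb.1) bAB cCD dCD,
      rI_split_y f A B C D a' b' c c' d H.cont (sx _ ra.1) (sx _ rb.1) cCD (sy _ rc.2) dCD,
      rI_split_y f A B C D a' b' c' d' d H.cont (sx _ ra.1) (sx _ rb.1) (sy _ rc.2) (sy _ rd.2) dCD]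
    rw [H.rI_zero' a a' c d hA ra.1.1 (sx _ ra.1).2 hC hcd.le hD,
      H.rI_zero' b' b c d (sx _ rb.1).1 rb.1.2 hB hC hcd.le hD,
      H.rI_zero' a' b' c c' (sx _ ra.1).1 hab' (sx _ rb.1).2 hC rc.2.1 (sy _ rc.2).2,
      H.rI_zero' a' b' d' d (sx _ ra.1).1 hab' (sx _ rb.1).2 (sy _ rd.2).1 rd.2.2 hD]
    · ring
    · intro x hx y hy h
      have : y ≤ d' := hpd' (x, y) ⟨h, ⟨ra.1.1.trans hx.1.le, hx.2.le.trans rb.1.2⟩,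
        ⟨rd.2.1.trans hy.1.le, hy.2.le⟩⟩
      linarith [hy.1]
    · intro x hx y hy h
      have : c' ≤ y := hpc' (x, y) ⟨h, ⟨ra.1.1.trans hx.1.le, hx.2.le.trans rb.1.2⟩,
        ⟨hy.1.le, hy.2.le.trans rc.2.2⟩⟩
      linarith [hy.2]
    · intro x hx y hy h
      have : x ≤ b' := hpb' (x, y) ⟨h, ⟨rb.1.1.trans hx.1.le, hx.2.le⟩, ⟨hy.1.le, hy.2.le⟩⟩
      linarith [hx.1]
    · intro x hx y hy h
      have : a' ≤ x := hpa' (x, y) ⟨h, ⟨hx.1.le, hx.2.le.trans ra.1.2⟩, ⟨hy.1.le, hy.2.le⟩⟩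
      linarith [hx.2]
  have hcx : ∀ x ∈ Icc A B, ContinuousOn (fun y : ℝ => f (x + y * Complex.I)) (Icc C D) := by
    intro x hx
    apply H.cont.comp (by fun_prop)
    intro y hy
    rw [Complex.mem_reProdIm]
    simpa using ⟨hx, hy⟩
  have hcy : ∀ y ∈ Icc C D, ContinuousOn (fun x : ℝ => f (x + y * Complex.I)) (Icc A B) := by
    intro y hy
    apply H.cont.comp (by fun_prop)
    intro x hx
    rw [Complex.mem_reProdIm]
    simpa using ⟨hx, hy⟩
  have hGi : IntegrableOn G K' := H.int.mono_set inter_subset_left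
  have hL := H.L0
  have hvol : (Ioc a b ×ˢ Ioc c d) \ K' = (Ioc a b ×ˢ Ioc c d) \ K := by
    ext p
    simp only [hK', Set.mem_sdiff, mem_inter_iff, mem_prod]
    constructor
    · rintro ⟨h1, h2⟩
      exact ⟨h1, fun h => h2 ⟨h, Ioc_subset_Icc_self h1.1, Ioc_subset_Icc_self h1.2⟩⟩
    · rintro ⟨h1, h2⟩
      exact ⟨h1, fun h => h2 h.1⟩
  have B1 := rectB (fun x y => f (x + y * Complex.I)) G K' a' b' c' d' a b c d L M hab' hcd' hL
    ra.1.1 rb.1.2 rc.2.1 rd.2.2 hK'cl hK'R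
    (fun p hp t ht => H.lipx p hp.1 t (sx' t ht))
    (fun p hp => H.derx p hp.1) hGi hM1
    (fun y hy => (missB (fun x y => f (x + y * Complex.I)) a' b' c' d' L (b - a) (d - c) ya yb hL
      hab' (by linarith [ra.1.1, rb.1.2]) (by linarith [rc.2.1, rd.2.2]) hyax hybx
      (fun t ht => H.lipx _ hpb.1 t (sx' t ht))
      (fun t ht => H.lipy _ hpb.1 t (sy' t ht))
      (fun t ht => H.lipy _ hpa.1 t (sy' t ht)) y hy).trans hM2)
    ((hcx a' (sx _ ra.1)).mono sy') ((hcx b' (sx _ rb.1)).mono sy')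
  have hswap : MeasurePreserving (Prod.swap : ℝ × ℝ → ℝ × ℝ) volume volume :=
    Measure.measurePreserving_swap
  have hemb : MeasurableEmbedding (Prod.swap : ℝ × ℝ → ℝ × ℝ) :=
    (MeasurableEquiv.prodComm : ℝ × ℝ ≃ᵐ ℝ × ℝ).measurableEmbedding
  have hGi2 : IntegrableOn (fun p : ℝ × ℝ => Complex.I * G p.swap) (Prod.swap ⁻¹' K') := by
    have := (hswap.integrableOn_comp_preimage hemb (f := fun p => Complex.I * G p) (s := K')).2
      (hGi.const_mul Complex.I)
    exact this
  have hint2 : ∫ p in (Prod.swap ⁻¹' K'), Complex.I * G p.swap = Complex.I * ∫ p in K', G p := by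
    rw [hswap.setIntegral_preimage_emb hemb (fun p => Complex.I * G p) K', integral_const_mul]
  have hvol2 : volume.real ((Ioc c d ×ˢ Ioc a b) \ (Prod.swap ⁻¹' K'))
      = volume.real ((Ioc a b ×ˢ Ioc c d) \ K') := by
    have : (Ioc c d ×ˢ Ioc a b) \ (Prod.swap ⁻¹' K')
        = Prod.swap ⁻¹' ((Ioc a b ×ˢ Ioc c d) \ K') := by
      ext p; simp only [Set.mem_sdiff, mem_prod, mem_preimage, Prod.fst_swap, Prod.snd_swap]; tauto
    rw [this, measureReal_def, hswap.measure_preimage_emb hemb, measureReal_def]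
  have B2 := rectB (fun y x => f (x + y * Complex.I)) (fun p => Complex.I * G p.swap)
    (Prod.swap ⁻¹' K') c' d' a' b' c d a b L M hcd' hab' hL
    rc.2.1 rd.2.2 ra.1.1 rb.1.2 (hK'cl.preimage continuous_swap)
    (fun p hp => ⟨(hK'R hp).2, (hK'R hp).1⟩)
    (fun p hp t ht => H.lipy p.swap hp.1 t (sy' t ht))
    (fun p hp => H.dery p.swap hp.1) hGi2 hM1
    (fun y hy => (missB (fun y x => f (x + y * Complex.I)) c' d' a' b' L (d - c) (b - a) xc xd hL
      hcd' (by linarith [rc.2.1, rd.2.2]) (by linarith [ra.1.1, rb.1.2]) hxcx hxdx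
      (fun t ht => H.lipy _ hpd.1 t (sy' t ht))
      (fun t ht => H.lipx _ hpd.1 t (sx' t ht))
      (fun t ht => H.lipx _ hpc.1 t (sx' t ht)) y hy).trans hM3)
    ((hcy c' (sy _ rc.2)).mono sx') ((hcy d' (sy _ rd.2)).mono sx')
  rw [hint2, hvol2, hvol] at B2
  rw [hvol] at B1
  rw [hred]
  have e : rI f a' b' c' d' = Complex.I * (((∫ y in c'..d', f (b' + y * Complex.I))
      - ∫ y in c'..d', f (a' + y * Complex.I)) - ∫ p in K', G p)
      - (((∫ x in a'..b', f (x + d' * Complex.I)) - ∫ x in a'..b', f (x + c' * Complex.I))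
        - Complex.I * ∫ p in K', G p) := by
    unfold rI; ring
  rw [e]
  refine (norm_sub_le _ _).trans ?_
  rw [norm_mul, Complex.norm_I, one_mul]
  linarith

lemma vol_split (a m b c n d : ℝ) (S : Set (ℝ × ℝ)) (hS : MeasurableSet S)
    (h1 : a ≤ m) (h2 : m ≤ b) (h3 : c ≤ n) (h4 : n ≤ d) :
    MeasureTheory.volume.real ((Ioc a b ×ˢ Ioc c d) ∩ S) =
      (MeasureTheory.volume.real ((Ioc a m ×ˢ Ioc c n) ∩ S) +
        MeasureTheory.volume.real ((Ioc a m ×ˢ Ioc n d) ∩ S)) +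
      (MeasureTheory.volume.real ((Ioc m b ×ˢ Ioc c n) ∩ S) +
        MeasureTheory.volume.real ((Ioc m b ×ˢ Ioc n d) ∩ S)) := by
  have fin : ∀ a b c d : ℝ, MeasureTheory.volume ((Ioc a b ×ˢ Ioc c d) ∩ S) ≠ ⊤ := by
    intro a b c d
    apply ne_top_of_le_ne_top _ (MeasureTheory.measure_mono inter_subset_left)
    rw [MeasureTheory.Measure.volume_eq_prod, MeasureTheory.Measure.prod_prod]
    exact ENNReal.mul_ne_top (by simp) (by simp)
  have meas : ∀ a b c d : ℝ, MeasurableSet ((Ioc a b ×ˢ Ioc c d) ∩ S) := fun a b c d =>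
    (measurableSet_Ioc.prod measurableSet_Ioc).inter hS
  have hx : ∀ c d : ℝ, MeasureTheory.volume.real ((Ioc a b ×ˢ Ioc c d) ∩ S) =
      MeasureTheory.volume.real ((Ioc a m ×ˢ Ioc c d) ∩ S) +
        MeasureTheory.volume.real ((Ioc m b ×ˢ Ioc c d) ∩ S) := by
    intro c d
    rw [← MeasureTheory.measureReal_union _ (meas _ _ _ _) (fin _ _ _ _) (fin _ _ _ _),
      ← union_inter_distrib_right, ← union_prod, Ioc_union_Ioc_eq_Ioc h1 h2]
    rw [Set.disjoint_left]
    rintro ⟨x, y⟩ ⟨⟨hx, -⟩, -⟩ ⟨⟨hx', -⟩, -⟩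
    exact absurd hx.2 (not_le.2 hx'.1)
  have hy : ∀ a b : ℝ, MeasureTheory.volume.real ((Ioc a b ×ˢ Ioc c d) ∩ S) =
      MeasureTheory.volume.real ((Ioc a b ×ˢ Ioc c n) ∩ S) +
        MeasureTheory.volume.real ((Ioc a b ×ˢ Ioc n d) ∩ S) := by
    intro a b
    rw [← MeasureTheory.measureReal_union _ (meas _ _ _ _) (fin _ _ _ _) (fin _ _ _ _),
      ← union_inter_distrib_right, ← prod_union, Ioc_union_Ioc_eq_Ioc h3 h4]
    rw [Set.disjoint_left]
    rintro ⟨x, y⟩ ⟨⟨-, hx⟩, -⟩ ⟨⟨-, hx'⟩, -⟩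
    exact absurd hx.2 (not_le.2 hx'.1)
  rw [hx, hy, hy]

lemma LMData.ind {f : ℂ → ℂ} {G : ℝ × ℝ → ℂ} {K : Set (ℝ × ℝ)} {A B C D L : ℝ}
    (H : LMData f G K A B C D L) (δ M : ℝ) (hδ : 0 < δ) (hM1 : 6 * L ≤ M) (k : ℕ) :
    ∀ a b c d : ℝ, A ≤ a → a < b → b ≤ B → C ≤ c → c < d → d ≤ D →
    L * (3 * (d - c) + (b - a)) ≤ M * (b - a) → L * (3 * (b - a) + (d - c)) ≤ M * (d - c) →
    b - a ≤ 2 ^ k * δ → d - c ≤ 2 ^ k * δ →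
    ‖rI f a b c d‖ ≤ 2 * M * MeasureTheory.volume.real
      ((Ioc a b ×ˢ Ioc c d) ∩ (Metric.cthickening δ K \ K)) := by
  have hM0 : 0 ≤ M := by linarith [H.L0]
  induction k with
  | zero =>
    intro a b c d hA hab hB hC hcd hD hM2 hM3 h1 h2
    rw [pow_zero, one_mul] at h1 h2
    by_cases hne : (K ∩ Icc a b ×ˢ Icc c d).Nonempty
    · have := H.rectC a b c d M hA hab hB hC hcd hD hM1 hM2 hM3 hne
      have he : (Ioc a b ×ˢ Ioc c d) ∩ (Metric.cthickening δ K \ K) =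
          (Ioc a b ×ˢ Ioc c d) \ K := by
        ext p
        refine ⟨fun h => ⟨h.1, h.2.2⟩, fun h => ⟨h.1, ?_, h.2⟩⟩
        obtain ⟨q, hq, hq1, hq2⟩ := hne
        obtain ⟨⟨hp1, hp2⟩, -⟩ := h
        apply Metric.mem_cthickening_of_dist_le p q δ K hq
        rw [Prod.dist_eq]
        apply max_le
        · rw [Real.dist_eq, abs_le]
          constructor <;> linarith [hp1.1, hp1.2, hq1.1, hq1.2]
        · rw [Real.dist_eq, abs_le]
          constructor <;> linarith [hp2.1, hp2.2, hq2.1, hq2.2]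
      rw [he]
      exact this
    · rw [H.rI_zero' a b c d hA hab.le hB hC hcd.le hD, norm_zero]
      · positivity
      · intro x hx y hy hxy
        exact hne ⟨(x, y), hxy, Ioo_subset_Icc_self hx, Ioo_subset_Icc_self hy⟩
  | succ k ih =>
    intro a b c d hA hab hB hC hcd hD hM2 hM3 h1 h2
    have hm1 : a < (a + b) / 2 := by linarith
    have hm2 : (a + b) / 2 < b := by linarith
    have hn1 : c < (c + d) / 2 := by linarith
    have hn2 : (c + d) / 2 < d := by linarith
    set m := (a + b) / 2 with hm
    set n := (c + d) / 2 with hn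
    have ha' : a ∈ Icc A B := ⟨by linarith, by linarith⟩
    have hm' : m ∈ Icc A B := ⟨by linarith, by linarith⟩
    have hb' : b ∈ Icc A B := ⟨by linarith, by linarith⟩
    have hc' : c ∈ Icc C D := ⟨by linarith, by linarith⟩
    have hn' : n ∈ Icc C D := ⟨by linarith, by linarith⟩
    have hd' : d ∈ Icc C D := ⟨by linarith, by linarith⟩
    rw [rI_split_x f A B C D a m b c d H.cont ha' hm' hb' hc' hd',
      rI_split_y f A B C D a m c n d H.cont ha' hm' hc' hn' hd',
      rI_split_y f A B C D m b c n d H.cont hm' hb' hc' hn' hd',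
      vol_split a m b c n d _ (Metric.isClosed_cthickening.measurableSet.diff
        H.closed.measurableSet) hm1.le hm2.le hn1.le hn2.le]
    rw [pow_succ] at h1 h2
    have e1 : m - a = (b - a) / 2 := by rw [hm]; ring
    have e2 : b - m = (b - a) / 2 := by rw [hm]; ring
    have e3 : n - c = (d - c) / 2 := by rw [hn]; ring
    have e4 : d - n = (d - c) / 2 := by rw [hn]; ring
    have i1 := ih a m c n hA hm1 hm'.2 hC hn1 hn'.2 (by rw [e1, e3]; linarith)
      (by rw [e1, e3]; linarith) (by linarith) (by linarith)
    have i2 := ih a m n d hA hm1 hm'.2 hn'.1 hn2 hD (by rw [e1, e4]; linarith)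
      (by rw [e1, e4]; linarith) (by linarith) (by linarith)
    have i3 := ih m b c n hm'.1 hm2 hB hC hn1 hn'.2 (by rw [e2, e3]; linarith)
      (by rw [e2, e3]; linarith) (by linarith) (by linarith)
    have i4 := ih m b n d hm'.1 hm2 hB hn'.1 hn2 hD (by rw [e2, e4]; linarith)
      (by rw [e2, e4]; linarith) (by linarith) (by linarith)
    refine (norm_add_le _ _).trans ?_
    have j1 := norm_add_le (rI f a m c n) (rI f a m n d)
    have j2 := norm_add_le (rI f m b c n) (rI f m b n d)
    linarith

lemma LMData.zero {f : ℂ → ℂ} {G : ℝ × ℝ → ℂ} {K : Set (ℝ × ℝ)} {A B C D L : ℝ}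
    (H : LMData f G K A B C D L) (hAB : A < B) (hCD : C < D) : rI f A B C D = 0 := by
  obtain ⟨M, hM1, hM2, hM3⟩ : ∃ M : ℝ, 6 * L ≤ M ∧
      L * (3 * (D - C) + (B - A)) ≤ M * (B - A) ∧ L * (3 * (B - A) + (D - C)) ≤ M * (D - C) := by
    have p1 : 0 < B - A := by linarith
    have p2 : 0 < D - C := by linarith
    refine ⟨max (6 * L) (max (L * (3 * (D - C) + (B - A)) / (B - A))
      (L * (3 * (B - A) + (D - C)) / (D - C))), le_max_left _ _, ?_, ?_⟩
    · rw [← div_le_iff₀ p1]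
      exact (le_max_left _ _).trans (le_max_right _ _)
    · rw [← div_le_iff₀ p2]
      exact (le_max_right _ _).trans (le_max_right _ _)
  have hM0 : 0 ≤ M := by linarith [H.L0]
  have hKc : IsCompact K := (isCompact_Icc.prod isCompact_Icc).of_isClosed_subset H.closed H.sub
  have key : ∀ δ : ℝ, 0 < δ → ‖rI f A B C D‖ ≤ 2 * M * MeasureTheory.volume.real
      (Metric.cthickening δ K \ K) := by
    intro δ hδ
    obtain ⟨k, hk⟩ : ∃ k : ℕ, max (B - A) (D - C) / δ ≤ 2 ^ k := by
      obtain ⟨k, hk⟩ := pow_unbounded_of_one_lt (max (B - A) (D - C) / δ) (one_lt_two)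
      exact ⟨k, hk.le⟩
    rw [div_le_iff₀ hδ] at hk
    refine (H.ind δ M hδ hM1 k A B C D le_rfl hAB le_rfl le_rfl hCD le_rfl hM2 hM3
      ((le_max_left _ _).trans hk) ((le_max_right _ _).trans hk)).trans ?_
    gcongr
    · exact ne_top_of_le_ne_top (hKc.cthickening.measure_ne_top)
        (MeasureTheory.measure_mono sdiff_subset)
    · exact inter_subset_right
  have lim : Tendsto (fun δ : ℝ => 2 * M * MeasureTheory.volume.real (Metric.cthickening δ K \ K))
      (𝓝[>] 0) (𝓝 (2 * M * 0)) := by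
    apply Tendsto.const_mul
    have h0 := (tendsto_measure_cthickening_of_isCompact (μ := MeasureTheory.volume) hKc)
    have h1 := (ENNReal.tendsto_toReal hKc.measure_ne_top).comp (h0.mono_left
      (nhdsWithin_le_nhds (s := Ioi 0)))
    have h2 := h1.sub_const (MeasureTheory.volume K).toReal
    rw [sub_self] at h2
    refine h2.congr' ?_
    filter_upwards [self_mem_nhdsWithin] with δ hδ
    have := MeasureTheory.measureReal_sdiff (μ := MeasureTheory.volume)
      (Metric.self_subset_cthickening (δ := δ) K) H.closed.measurableSet hKc.cthickening.measure_ne_top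
    rw [this]
    rfl
  have := ge_of_tendsto lim (by
    filter_upwards [self_mem_nhdsWithin] with δ hδ using key δ hδ)
  rw [mul_zero] at this
  exact norm_le_zero_iff.1 this

/-- Hypotheses on a ball for the local Looman-Menchoff step. -/
structure LMBall (f G : ℂ → ℂ) (E U : Set ℂ) (L : ℝ) : Prop where
  U_open : IsOpen U
  cont : ContinuousOn f U
  closed : ∀ z ∈ U, z ∉ E → ∀ᶠ w in 𝓝 z, w ∉ E
  diff : ∀ z ∈ U, z ∉ E → DifferentiableAt ℂ f z
  L0 : 0 ≤ L
  derx : ∀ z ∈ U, HasDerivAt (fun t : ℝ => f (z + t)) (G z) 0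
  dery : ∀ z ∈ U, HasDerivAt (fun t : ℝ => f (z + t * Complex.I)) (Complex.I * G z) 0
  lipx : ∀ z ∈ U, z ∈ E → ∀ t : ℝ, z + t ∈ U → ‖f (z + t) - f z‖ ≤ L * |t|
  lipy : ∀ z ∈ U, z ∈ E → ∀ t : ℝ, z + t * Complex.I ∈ U →
    ‖f (z + t * Complex.I) - f z‖ ≤ L * |t|

lemma LMBall.data {f G : ℂ → ℂ} {E U : Set ℂ} {L : ℝ} (H : LMBall f G E U L)
    (A B C D : ℝ) (hR : Icc A B ×ℂ Icc C D ⊆ U) :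
    LMData f (fun p => G (p.1 + p.2 * Complex.I))
      {p | p ∈ Icc A B ×ˢ Icc C D ∧ (p.1 + p.2 * Complex.I : ℂ) ∈ E} A B C D L := by
  have hmem : ∀ x ∈ Icc A B, ∀ y ∈ Icc C D, (x + y * Complex.I : ℂ) ∈ U := by
    intro x hx y hy
    apply hR
    rw [Complex.mem_reProdIm]
    simpa using ⟨hx, hy⟩
  have hcl : IsClosed {p : ℝ × ℝ | p ∈ Icc A B ×ˢ Icc C D ∧ (p.1 + p.2 * Complex.I : ℂ) ∈ E} := by
    rw [← isOpen_compl_iff, isOpen_iff_mem_nhds]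
    rintro p hp
    by_cases h : p ∈ Icc A B ×ˢ Icc C D
    · have hE : (p.1 + p.2 * Complex.I : ℂ) ∉ E := fun hE => hp ⟨h, hE⟩
      have h1 := H.closed _ (hmem _ h.1 _ h.2) hE
      have hc : Continuous (fun p : ℝ × ℝ => (p.1 + p.2 * Complex.I : ℂ)) := by fun_prop
      filter_upwards [hc.continuousAt.eventually h1] with q hq hq'
      exact hq hq'.2
    · have : (Icc A B ×ˢ Icc C D)ᶜ ∈ 𝓝 p :=
        (isClosed_Icc.prod isClosed_Icc).isOpen_compl.mem_nhds h
      filter_upwards [this] with q hq hq'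
      exact hq hq'.1
  have hsub : {p : ℝ × ℝ | p ∈ Icc A B ×ˢ Icc C D ∧ (p.1 + p.2 * Complex.I : ℂ) ∈ E} ⊆
      Icc A B ×ˢ Icc C D := fun p hp => hp.1
  refine ⟨H.cont.mono hR, hcl, hsub, ?_, H.L0, ?_, ?_, ?_, ?_, ?_⟩
  · intro x hx y hy hxy
    exact H.diff _ (hmem x hx y hy) (fun h => hxy ⟨⟨hx, hy⟩, h⟩)
  · rintro ⟨x, y⟩ ⟨⟨hx, hy⟩, hE⟩ t ht
    have e : ((x : ℂ) + y * Complex.I) + ((t - x : ℝ) : ℂ) = t + y * Complex.I := by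
      push_cast; ring
    have := H.lipx _ (hmem x hx y hy) hE (t - x) (by rw [e]; exact hmem t ht y hy)
    rwa [e] at this
  · rintro ⟨x, y⟩ ⟨⟨hx, hy⟩, hE⟩ t ht
    have e : ((x : ℂ) + y * Complex.I) + ((t - y : ℝ) : ℂ) * Complex.I = x + t * Complex.I := by
      push_cast; ring
    have := H.lipy _ (hmem x hx y hy) hE (t - y) (by rw [e]; exact hmem x hx t ht)
    rwa [e] at this
  · rintro ⟨x, y⟩ ⟨⟨hx, hy⟩, hE⟩
    have h := H.derx _ (hmem x hx y hy)
    have h' : HasDerivAt (fun t : ℝ => f (((x : ℂ) + y * Complex.I) + (t : ℂ)))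
      (G (x + y * Complex.I)) (x - x) := by rwa [sub_self]
    have := h'.comp_sub_const x x
    refine this.congr_of_eventuallyEq (Eventually.of_forall fun t => ?_)
    simp only []
    congr 1; push_cast; ring
  · rintro ⟨x, y⟩ ⟨⟨hx, hy⟩, hE⟩
    have h := H.dery _ (hmem x hx y hy)
    have h' : HasDerivAt (fun t : ℝ => f (((x : ℂ) + y * Complex.I) + (t : ℂ) * Complex.I))
      (Complex.I * G (x + y * Complex.I)) (y - y) := by rwa [sub_self]
    have := h'.comp_sub_const y y
    refine this.congr_of_eventuallyEq (Eventually.of_forall fun t => ?_)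
    simp only []
    congr 1; push_cast; ring
  · have hRc : IsCompact (Icc A B ×ℂ Icc C D) := isCompact_Icc.reProdIm isCompact_Icc
    obtain ⟨η, hη, hηU⟩ := hRc.exists_cthickening_subset_open H.U_open hR
    have hmem' : ∀ p ∈ {p : ℝ × ℝ | p ∈ Icc A B ×ˢ Icc C D ∧ (p.1 + p.2 * Complex.I : ℂ) ∈ E},
        ∀ t : ℝ, |t| ≤ η → ((p.1 + p.2 * Complex.I) + t : ℂ) ∈ U := by
      rintro ⟨x, y⟩ ⟨⟨hx, hy⟩, hE⟩ t ht
      apply hηU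
      apply Metric.mem_cthickening_of_dist_le _ (x + y * Complex.I : ℂ)
      · rw [Complex.mem_reProdIm]
        simpa using ⟨hx, hy⟩
      · simpa [dist_eq_norm] using ht
    have hfin : MeasureTheory.volume
        {p : ℝ × ℝ | p ∈ Icc A B ×ˢ Icc C D ∧ (p.1 + p.2 * Complex.I : ℂ) ∈ E} < ⊤ :=
      ((isCompact_Icc.prod isCompact_Icc).of_isClosed_subset hcl hsub).measure_lt_top
    have : MeasureTheory.IsFiniteMeasure (MeasureTheory.volume.restrict
        {p : ℝ × ℝ | p ∈ Icc A B ×ˢ Icc C D ∧ (p.1 + p.2 * Complex.I : ℂ) ∈ E}) :=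
      ⟨by rwa [MeasureTheory.Measure.restrict_apply_univ]⟩
    refine MeasureTheory.Integrable.of_bound ?_ L ?_
    · refine aestronglyMeasurable_of_tendsto_ae atTop (f := fun (n : ℕ) (p : ℝ × ℝ) =>
        (η / (n + 1))⁻¹ • (f ((p.1 + p.2 * Complex.I) + ((η / (n + 1) : ℝ) : ℂ)) -
          f (p.1 + p.2 * Complex.I))) ?_ ?_
      · intro n
        apply ContinuousOn.aestronglyMeasurable _ hcl.measurableSet
        apply ContinuousOn.fun_const_smul
        apply ContinuousOn.sub
        · apply H.cont.comp (by fun_prop)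
          intro p hp
          apply hmem' p hp
          rw [abs_of_pos (by positivity)]
          apply div_le_self hη.le
          linarith [(Nat.cast_nonneg n : (0:ℝ) ≤ n)]
        · apply H.cont.comp (by fun_prop)
          intro p hp
          exact hmem _ hp.1.1 _ hp.1.2
      · filter_upwards [MeasureTheory.ae_restrict_mem hcl.measurableSet] with p hp
        have h := (H.derx _ (hmem _ hp.1.1 _ hp.1.2)).tendsto_slope_zero_right
        have h0 : Tendsto (fun n : ℕ => η / ((n : ℝ) + 1)) atTop (𝓝[>] 0) := by
          rw [tendsto_nhdsWithin_iff]
          constructor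
          · have := (tendsto_one_div_add_atTop_nhds_zero_nat (𝕜 := ℝ)).const_mul η
            simpa [div_eq_mul_inv] using this
          · exact Eventually.of_forall fun n => by
              have : (0:ℝ) < η / ((n : ℝ) + 1) := by positivity
              exact this
        have := h.comp h0
        simpa [Function.comp_def] using this
    · filter_upwards [MeasureTheory.ae_restrict_mem hcl.measurableSet] with p hp
      have h := H.derx _ (hmem _ hp.1.1 _ hp.1.2)
      refine h.le_of_lip' H.L0 ?_
      have : Metric.ball (0:ℝ) η ∈ 𝓝 0 := Metric.ball_mem_nhds _ hη
      filter_upwards [this] with t ht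
      have ht' : |t| < η := by simpa using ht
      have := H.lipx _ (hmem _ hp.1.1 _ hp.1.2) hp.2 t (hmem' p hp t ht'.le)
      simpa using this

lemma rI_eq_zero_of_data {f G : ℂ → ℂ} {E U : Set ℂ} {L : ℝ} (H : LMBall f G E U L)
    (a b c d : ℝ) (hR : uIcc a b ×ℂ uIcc c d ⊆ U) : rI f a b c d = 0 := by
  have base : ∀ a b c d : ℝ, a ≤ b → c ≤ d → uIcc a b ×ℂ uIcc c d ⊆ U → rI f a b c d = 0 := by
    intro a b c d hab hcd hR
    rw [uIcc_of_le hab, uIcc_of_le hcd] at hR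
    rcases hab.eq_or_lt with rfl | hab
    · simp [rI]
    rcases hcd.eq_or_lt with rfl | hcd
    · simp [rI]
    exact (H.data a b c d hR).zero hab hcd
  have sx : ∀ a b c d : ℝ, rI f a b c d = - rI f b a c d := by
    intro a b c d
    unfold rI
    rw [intervalIntegral.integral_symm b a, intervalIntegral.integral_symm b a]
    ring
  have sy : ∀ a b c d : ℝ, rI f a b c d = - rI f a b d c := by
    intro a b c d
    unfold rI
    rw [intervalIntegral.integral_symm d c, intervalIntegral.integral_symm d c]
    ring
  rcases le_total a b with hab | hab <;> rcases le_total c d with hcd | hcd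
  · exact base _ _ _ _ hab hcd hR
  · rw [sy, base _ _ _ _ hab hcd (by rwa [uIcc_comm d c]), neg_zero]
  · rw [sx, base _ _ _ _ hab hcd (by rwa [uIcc_comm b a]), neg_zero]
  · rw [sx, sy, base _ _ _ _ hab hcd (by rwa [uIcc_comm b a, uIcc_comm d c]), neg_zero, neg_zero]

lemma LMBall.diffOn {f G : ℂ → ℂ} {E : Set ℂ} {z₀ : ℂ} {ρ L : ℝ}
    (H : LMBall f G E (Metric.ball z₀ ρ) L) : DifferentiableOn ℂ f (Metric.ball z₀ ρ) := by
  have hc : Complex.IsConservativeOn f (Metric.ball z₀ ρ) := by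
    intro z w hzw
    rw [← add_eq_zero_iff_eq_neg, Complex.wedgeIntegral_add_wedgeIntegral_eq]
    exact rI_eq_zero_of_data H z.re w.re z.im w.im hzw
  exact (Complex.IsConservativeOn.isExactOn_ball H.cont hc).differentiableOn Metric.isOpen_ball

/-- **Looman-Menchoff theorem**. -/
lemma looman_menchoff {U : Set ℂ} (hU : IsOpen U) {f : ℂ → ℂ} (hf : ContinuousOn f U)
    (h : ∀ z ∈ U, ∃ A : ℂ, HasDerivAt (fun t : ℝ => f (z + t)) A 0 ∧
      HasDerivAt (fun t : ℝ => f (z + t * Complex.I)) (Complex.I * A) 0) :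
    DifferentiableOn ℂ f U := by
  choose! G hGx hGy using h
  set E : Set ℂ := {z | ∀ᶠ w in 𝓝 z, DifferentiableAt ℂ f w}ᶜ with hE
  have hEc : IsClosed E := by
    rw [hE, isClosed_compl_iff]
    exact isOpen_setOfPred_eventually_nhds
  have hdiff : ∀ z, z ∉ E → DifferentiableAt ℂ f z := by
    intro z hz
    rw [hE, notMem_compl_iff] at hz
    exact Eventually.self_of_nhds hz
  suffices hs : ∀ z ∈ U, z ∉ E from
    fun z hz => (hdiff z (hs z hz)).differentiableWithinAt
  intro e₀ he₀U he₀
  obtain ⟨r, hr, hrU⟩ : ∃ r : ℝ, 0 < r ∧ Metric.ball e₀ (2 * r) ⊆ U := by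
    obtain ⟨s, hs, hsU⟩ := Metric.isOpen_iff.1 hU e₀ he₀U
    exact ⟨s / 2, by linarith, by rwa [mul_div_cancel₀ _ (two_ne_zero)]⟩
  have hrU' : Metric.ball e₀ r ⊆ U := (Metric.ball_subset_ball (by linarith)).trans hrU
  have hlc : IsLocallyClosed (E ∩ Metric.ball e₀ r) :=
    hEc.isLocallyClosed.inter Metric.isOpen_ball.isLocallyClosed
  have : LocallyCompactSpace (↥(E ∩ Metric.ball e₀ r)) := hlc.locallyCompactSpace
  have : Nonempty (↥(E ∩ Metric.ball e₀ r)) := ⟨⟨e₀, he₀, Metric.mem_ball_self hr⟩⟩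
  have hin : ∀ z ∈ Metric.ball e₀ r, ∀ c : ℂ, ‖c‖ ≤ r → z + c ∈ U := by
    intro z hz c hc
    apply hrU
    rw [Metric.mem_ball] at hz ⊢
    calc dist (z + c) e₀ ≤ dist (z + c) z + dist z e₀ := dist_triangle _ _ _
      _ < 2 * r := by
        have : dist (z + c) z = ‖c‖ := by simp [dist_eq_norm]
        linarith
  have hle : ∀ n : ℕ, r / ((n : ℝ) + 1) ≤ r := fun n => by
    apply div_le_self hr.le
    linarith [(Nat.cast_nonneg n : (0:ℝ) ≤ n)]
  obtain ⟨n, z₁, hz₁⟩ := nonempty_interior_of_iUnion_of_closed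
    (X := ↥(E ∩ Metric.ball e₀ r)) (f := fun n : ℕ =>
      {z : ↥(E ∩ Metric.ball e₀ r) | ∀ t : ℝ, |t| ≤ r / ((n : ℝ) + 1) →
        ‖f (z.1 + t) - f z.1‖ ≤ n * |t| ∧ ‖f (z.1 + t * Complex.I) - f z.1‖ ≤ n * |t|})
    (by
      intro n
      simp only [ofPred_forall]
      refine isClosed_iInter fun t => isClosed_iInter fun ht => ?_
      have hc0 : Continuous (fun z : ↥(E ∩ Metric.ball e₀ r) => f z.1) :=
        hf.comp_continuous continuous_subtype_val fun z => hrU' z.2.2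
      have hc1 : Continuous (fun z : ↥(E ∩ Metric.ball e₀ r) => f (z.1 + t)) :=
        hf.comp_continuous (by fun_prop) fun z => hin _ z.2.2 _ (by
          rw [Complex.norm_real]; exact ht.trans (hle n))
      have hc2 : Continuous (fun z : ↥(E ∩ Metric.ball e₀ r) => f (z.1 + t * Complex.I)) :=
        hf.comp_continuous (by fun_prop) fun z => hin _ z.2.2 _ (by
          rw [norm_mul, Complex.norm_real, Complex.norm_I, mul_one]; exact ht.trans (hle n))
      exact (isClosed_le (hc1.sub hc0).norm continuous_const).inter
        (isClosed_le (hc2.sub hc0).norm continuous_const))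
    (by
      rw [eq_univ_iff_forall]
      intro z
      rw [mem_iUnion]
      have hb : ∀ g : ℝ → ℂ, ∀ g' : ℂ, HasDerivAt g g' 0 → ∃ N : ℕ, ∀ n ≥ N, ∀ t : ℝ,
          |t| ≤ r / ((n : ℝ) + 1) → ‖g t - g 0‖ ≤ n * |t| := by
        intro g g' hg
        obtain ⟨C, hC⟩ := hg.isBigO_sub.bound
        obtain ⟨η, hη, hη'⟩ := Metric.eventually_nhds_iff.1 hC
        obtain ⟨N1, hN1⟩ := exists_nat_ge C
        obtain ⟨N2, hN2⟩ := exists_nat_gt (r / η)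
        refine ⟨max N1 N2, fun n hn t ht => ?_⟩
        have h1 : (N1 : ℝ) ≤ n := by exact_mod_cast (le_max_left _ _).trans hn
        have h2 : (N2 : ℝ) ≤ n := by exact_mod_cast (le_max_right _ _).trans hn
        have h3 : |t| < η := by
          refine ht.trans_lt ?_
          rw [div_lt_iff₀ (by positivity)]
          rw [div_lt_iff₀ hη] at hN2
          nlinarith
        have := hη' (y := t) (by simpa using h3)
        simp only [sub_zero, Real.norm_eq_abs] at this
        refine this.trans ?_
        gcongr
        linarith
      obtain ⟨N1, h1⟩ := hb _ _ (hGx z.1 (hrU' z.2.2))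
      obtain ⟨N2, h2⟩ := hb _ _ (hGy z.1 (hrU' z.2.2))
      refine ⟨max N1 N2, fun t ht => ⟨?_, ?_⟩⟩
      · simpa using h1 _ (le_max_left _ _) t ht
      · simpa using h2 _ (le_max_right _ _) t ht)
  rw [mem_interior_iff_mem_nhds, Metric.mem_nhds_iff] at hz₁
  obtain ⟨ρ₀, hρ₀, hball⟩ := hz₁
  obtain ⟨z₀, hz₀E, hz₀b⟩ := z₁
  have hpos : 0 < r / ((n : ℝ) + 1) := by positivity
  obtain ⟨ρ, hρ, k1, k2, k3⟩ : ∃ ρ : ℝ, 0 < ρ ∧ ρ ≤ ρ₀ ∧ ρ ≤ r - dist z₀ e₀ ∧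
      2 * ρ ≤ r / ((n : ℝ) + 1) := by
    have : 0 < r - dist z₀ e₀ := by rw [Metric.mem_ball] at hz₀b; linarith
    refine ⟨min ρ₀ (min (r - dist z₀ e₀) (r / ((n : ℝ) + 1) / 2)), by positivity,
      min_le_left _ _, (min_le_right _ _).trans (min_le_left _ _), ?_⟩
    have := (min_le_right ρ₀ _).trans (min_le_right (r - dist z₀ e₀) (r / ((n : ℝ) + 1) / 2))
    linarith
  have hsub : Metric.ball z₀ ρ ⊆ Metric.ball e₀ r := Metric.ball_subset_ball' (by linarith)
  have hEn : ∀ z ∈ Metric.ball z₀ ρ, z ∈ E → ∀ t : ℝ, |t| ≤ r / ((n : ℝ) + 1) →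
        ‖f (z + t) - f z‖ ≤ n * |t| ∧ ‖f (z + t * Complex.I) - f z‖ ≤ n * |t| := by
    intro z hz hzE
    have : (⟨z, hzE, hsub hz⟩ : ↥(E ∩ Metric.ball e₀ r)) ∈
        Metric.ball (⟨z₀, hz₀E, hz₀b⟩ : ↥(E ∩ Metric.ball e₀ r)) ρ₀ := by
      rw [Metric.mem_ball] at hz ⊢
      exact lt_of_lt_of_le hz k1
    exact hball this
  have hclose : ∀ z ∈ Metric.ball z₀ ρ, ∀ c : ℂ, z + c ∈ Metric.ball z₀ ρ →
      ‖c‖ ≤ r / ((n : ℝ) + 1) := by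
    intro z hz c hc
    rw [Metric.mem_ball] at hz hc
    have : ‖c‖ = dist (z + c) z := by simp [dist_eq_norm]
    rw [this]
    have := dist_triangle_right (z + c) z z₀
    linarith
  have H : LMBall f G E (Metric.ball z₀ ρ) n := by
    refine ⟨Metric.isOpen_ball, hf.mono (hsub.trans hrU'), ?_, fun z _ hz => hdiff z hz,
      Nat.cast_nonneg n, fun z hz => hGx z (hrU' (hsub hz)), fun z hz => hGy z (hrU' (hsub hz)),
      ?_, ?_⟩
    · intro z _ hz
      exact hEc.isOpen_compl.mem_nhds hz
    · intro z hz hzE t ht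
      have := hclose z hz _ ht
      rw [Complex.norm_real] at this
      exact (hEn z hz hzE t this).1
    · intro z hz hzE t ht
      have := hclose z hz _ ht
      rw [norm_mul, Complex.norm_real, Complex.norm_I, mul_one] at this
      exact (hEn z hz hzE t this).2
  apply hz₀E
  have hd := H.diffOn
  filter_upwards [Metric.ball_mem_nhds z₀ hρ] with w hw
  exact hd.differentiableAt (Metric.isOpen_ball.mem_nhds hw)

lemma right_deriv_of_tendsto (g : ℝ → ℂ) (x : ℝ) (A : ℂ)
    (h : Tendsto (fun ε : ℝ => (ε : ℂ)⁻¹ * (g (x + ε) - g x)) (𝓝[>] 0) (𝓝 A)) :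
    HasDerivWithinAt g A (Ici x) x := by
  rw [← hasDerivWithinAt_Ioi_iff_Ici, hasDerivWithinAt_iff_tendsto_slope' (by simp)]
  have hm : Tendsto (fun y : ℝ => y - x) (𝓝[>] x) (𝓝[>] 0) := by
    rw [tendsto_nhdsWithin_iff]
    constructor
    · have : Tendsto (fun y : ℝ => y - x) (𝓝 x) (𝓝 (x - x)) :=
        (continuous_id.sub continuous_const).tendsto x
      rw [sub_self] at this
      exact this.mono_left nhdsWithin_le_nhds
    · filter_upwards [self_mem_nhdsWithin] with y hy
      have hy' : x < y := hy
      have : 0 < y - x := sub_pos.2 hy'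
      exact this
  refine (h.comp hm).congr fun y => ?_
  simp only [Function.comp, slope_def_module, Complex.real_smul, Complex.ofReal_inv]
  congr 3
  ring_nf

lemma deriv_of_two_sided (g : ℝ → ℂ) (A : ℂ)
    (h1 : Tendsto (fun ε : ℝ => (ε : ℂ)⁻¹ * (g ε - g 0)) (𝓝[>] 0) (𝓝 A))
    (h2 : Tendsto (fun ε : ℝ => (ε : ℂ)⁻¹ * (g (-ε) - g 0)) (𝓝[>] 0) (𝓝 (-A))) :
    HasDerivAt g A 0 := by
  rw [hasDerivAt_iff_tendsto_slope_zero, ← nhdsLT_sup_nhdsGT, tendsto_sup]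
  constructor
  · have hm : Tendsto (fun y : ℝ => -y) (𝓝[<] 0) (𝓝[>] 0) := by
      have := tendsto_neg_nhdsLT (a := (0 : ℝ))
      rwa [neg_zero] at this
    have := (h2.comp hm).neg
    rw [neg_neg] at this
    refine this.congr fun t => ?_
    simp only [Function.comp, Complex.real_smul, Complex.ofReal_neg, neg_neg, zero_add,
      Complex.ofReal_inv]
    rw [inv_neg]
    ring
  · refine h1.congr fun t => ?_
    simp only [Complex.real_smul, zero_add, Complex.ofReal_inv]

lemma seg_const (u : ℝ × ℝ × ℝ → ℂ) (Ω : Set (ℝ × ℝ × ℝ)) (hu : ContinuousOn u Ω)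
    (p h : ℝ × ℝ × ℝ) (hp : ∀ t ∈ Icc (0 : ℝ) 1, p + t • h ∈ Ω)
    (hd : ∀ q ∈ Ω, Tendsto (fun ε : ℝ => (ε : ℂ)⁻¹ * (u (q + ε • h) - u q)) (𝓝[>] 0) (𝓝 0)) :
    u (p + h) = u p := by
  have := constant_of_has_deriv_right_zero (f := fun t : ℝ => u (p + t • h)) (a := 0) (b := 1)
    (hu.comp (by fun_prop) hp) (by
      intro x hx
      apply right_deriv_of_tendsto
      refine (hd _ (hp x ⟨hx.1, hx.2.le⟩)).congr fun ε => ?_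
      rw [add_assoc, ← add_smul]) 1 (by simp)
  simpa using this

lemma const_of_zero (u : ℝ × ℝ × ℝ → ℂ) (Ω : Set (ℝ × ℝ × ℝ)) (ho : IsOpen Ω)
    (hc : IsPreconnected Ω) (hu : ContinuousOn u Ω)
    (hd : ∀ q ∈ Ω, ∀ h : ℝ × ℝ × ℝ,
      Tendsto (fun ε : ℝ => (ε : ℂ)⁻¹ * (u (q + ε • h) - u q)) (𝓝[>] 0) (𝓝 0)) :
    ∀ p ∈ Ω, ∀ q ∈ Ω, u p = u q := by
  have hfd : ∀ p ∈ Ω, HasFDerivAt u (0 : ℝ × ℝ × ℝ →L[ℝ] ℂ) p := by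
    intro p hp
    obtain ⟨r, hr, hrΩ⟩ := Metric.isOpen_iff.1 ho p hp
    have he : u =ᶠ[𝓝 p] fun _ => u p := by
      filter_upwards [Metric.ball_mem_nhds p hr] with q hq
      have := seg_const u Ω hu p (q - p) (fun t ht => hrΩ (by
        have hcv := (convex_ball p r) (Metric.mem_ball_self hr) hq
          (sub_nonneg.2 ht.2) ht.1 (by ring)
        convert hcv using 1
        rw [smul_sub, sub_smul, one_smul]; abel)) (fun q hq => hd q hq _)
      simpa using this
    exact (hasFDerivAt_const (u p) p).congr_of_eventuallyEq he
  intro p hp q hq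
  exact ho.is_const_of_fderiv_eq_zero (𝕜 := ℝ) hc
    (fun p hp => (hfd p hp).differentiableAt.differentiableWithinAt)
    (fun p hp => (hfd p hp).fderiv) hp hq

lemma xi_add (a b : ℂ) (p q : ℝ × ℝ × ℝ) : xi a b (p + q) = xi a b p + xi a b q := by
  simp [xi]; ring

lemma xi_smul (a b : ℂ) (t : ℝ) (q : ℝ × ℝ × ℝ) : xi a b (t • q) = t * xi a b q := by
  simp [xi]; ring

lemma xi_section (a b : ℂ)
    (hab : a ∉ Set.range ((↑) : ℝ → ℂ) ∨ b ∉ Set.range ((↑) : ℝ → ℂ)) :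
    ∃ τ : ℝ × ℝ × ℝ, xi a b τ = Complex.I := by
  have him : ∀ a : ℂ, a ∉ Set.range ((↑) : ℝ → ℂ) → a.im ≠ 0 := fun a ha h0 =>
    ha ⟨a.re, Complex.ext (by simp) (by simp [h0])⟩
  rcases hab with h | h
  · have := him a h
    refine ⟨(-(a.re / a.im), 1 / a.im, 0), ?_⟩
    apply Complex.ext
    · simp [xi]; field_simp; simp
    · simp [xi]; field_simp
  · have := him b h
    refine ⟨(-(b.re / b.im), 0, 1 / b.im), ?_⟩
    apply Complex.ext
    · simp [xi]; field_simp; simp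
    · simp [xi]; field_simp

lemma xi_one (a b : ℂ) : xi a b (1, 0, 0) = 1 := by simp [xi]

lemma analytic_form (a b : ℂ)
    (hab : a ∉ Set.range ((↑) : ℝ → ℂ) ∨ b ∉ Set.range ((↑) : ℝ → ℂ))
    (Ω : Set (ℝ × ℝ × ℝ)) (ho : IsOpen Ω) (hconv : ConvexInDirection Ω (lineL a b))
    (u : ℝ × ℝ × ℝ → ℂ) (hu : ContinuousOn u Ω)
    (hd : ∀ p ∈ Ω, ∃ A : ℂ, ∀ h : ℝ × ℝ × ℝ,
      Tendsto (fun ε : ℝ => (ε : ℂ)⁻¹ * (u (p + ε • h) - u p)) (𝓝[>] 0) (𝓝 (xi a b h * A))) :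
    ∃ F : ℂ → ℂ, AnalyticOnNhd ℂ F (xi a b '' Ω) ∧ ∀ p ∈ Ω, u p = F (xi a b p) := by
  classical
  have hwd : ∀ p ∈ Ω, ∀ q ∈ Ω, xi a b q = xi a b p → u q = u p := by
    intro p hp q hq hpq
    have h0 : xi a b (q - p) = 0 := by
      have := xi_add a b (q - p) p
      rw [sub_add_cancel, hpq] at this
      exact right_eq_add.1 this
    have hL : q - p ∈ lineL a b := by
      have hre := congrArg Complex.re h0
      have him := congrArg Complex.im h0
      simp [xi] at hre him
      refine ⟨?_, ?_⟩
      · simpa using hre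
      · simpa using him
    have hs := hconv p hp q hq hL
    have := seg_const u Ω hu p (q - p) (fun t ht => hs (by
      rw [segment_eq_image']
      exact ⟨t, ht, rfl⟩)) (fun x hx => by
        obtain ⟨A, hA⟩ := hd x hx
        have := hA (q - p)
        rwa [h0, zero_mul] at this)
    simpa using this
  set F : ℂ → ℂ := fun w => if h : ∃ p ∈ Ω, xi a b p = w then u h.choose else 0 with hF
  have hFu : ∀ p ∈ Ω, u p = F (xi a b p) := by
    intro p hp
    have hex : ∃ q ∈ Ω, xi a b q = xi a b p := ⟨p, hp, rfl⟩
    rw [hF]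
    simp only [dif_pos hex]
    exact (hwd p hp _ hex.choose_spec.1 hex.choose_spec.2).symm
  obtain ⟨τ, hτ⟩ := xi_section a b hab
  have hxs : ∀ p : ℝ × ℝ × ℝ, ∀ w : ℂ, xi a b (p + ((w - xi a b p).re • (1, 0, 0) +
      (w - xi a b p).im • τ)) = w := by
    intro p w
    rw [xi_add, xi_add, xi_smul, xi_smul, xi_one, hτ, mul_one, Complex.re_add_im]
    ring
  have hcs : ∀ p : ℝ × ℝ × ℝ, Continuous (fun w : ℂ => p + ((w - xi a b p).re • (1, 0, 0) +
      (w - xi a b p).im • τ) : ℂ → ℝ × ℝ × ℝ) := by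
    intro p
    have h1 : Continuous (fun w : ℂ => (w - xi a b p).re) :=
      Complex.continuous_re.comp (continuous_id.sub continuous_const)
    have h2 : Continuous (fun w : ℂ => (w - xi a b p).im) :=
      Complex.continuous_im.comp (continuous_id.sub continuous_const)
    fun_prop
  have hev : ∀ p ∈ Ω, ∀ᶠ w in 𝓝 (xi a b p), (p + ((w - xi a b p).re • (1, 0, 0) +
      (w - xi a b p).im • τ) : ℝ × ℝ × ℝ) ∈ Ω := by
    intro p hp
    have := (hcs p).tendsto (xi a b p)
    simp only [sub_self, Complex.zero_re, Complex.zero_im, zero_smul, add_zero] at this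
    exact this.eventually (ho.mem_nhds hp)
  have hop : IsOpen (xi a b '' Ω) := by
    rw [isOpen_iff_mem_nhds]
    rintro _ ⟨p, hp, rfl⟩
    filter_upwards [hev p hp] with w hw
    exact ⟨_, hw, hxs p w⟩
  have hFc : ContinuousOn F (xi a b '' Ω) := by
    rintro _ ⟨p, hp, rfl⟩
    apply ContinuousAt.continuousWithinAt
    have hc : ContinuousAt (fun w : ℂ => u (p + ((w - xi a b p).re • (1, 0, 0) +
        (w - xi a b p).im • τ))) (xi a b p) := by
      refine ContinuousAt.comp (g := u) ?_ (hcs p).continuousAt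
      simp only [sub_self, Complex.zero_re, Complex.zero_im, zero_smul, add_zero]
      exact hu.continuousAt (ho.mem_nhds hp)
    refine hc.congr ?_
    filter_upwards [hev p hp] with w hw
    rw [hFu _ hw, hxs]
  have hdir : ∀ p ∈ Ω, ∀ A : ℂ, (∀ h : ℝ × ℝ × ℝ,
      Tendsto (fun ε : ℝ => (ε : ℂ)⁻¹ * (u (p + ε • h) - u p)) (𝓝[>] 0) (𝓝 (xi a b h * A))) →
      ∀ h : ℝ × ℝ × ℝ,
      HasDerivAt (fun t : ℝ => F (xi a b p + t * xi a b h)) (xi a b h * A) 0 := by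
    intro p hp A hA h
    have h1 : HasDerivAt (fun t : ℝ => u (p + t • h)) (xi a b h * A) 0 := by
      apply deriv_of_two_sided
      · simpa using hA h
      · have := hA (-h)
        have e : xi a b (-h) = - xi a b h := by
          have := xi_smul a b (-1) h
          simpa using this
        rw [e, neg_mul] at this
        simpa using this
    refine h1.congr_of_eventuallyEq ?_
    have hc : Continuous (fun t : ℝ => p + t • h) := by fun_prop
    have h0 := hc.tendsto 0
    rw [zero_smul, add_zero] at h0
    filter_upwards [h0.eventually (ho.mem_nhds hp)] with t ht
    rw [hFu _ ht, xi_add, xi_smul]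
  refine ⟨F, ?_, hFu⟩
  apply DifferentiableOn.analyticOnNhd _ hop
  apply looman_menchoff hop hFc
  rintro _ ⟨p, hp, rfl⟩
  obtain ⟨A, hA⟩ := hd p hp
  refine ⟨A, ?_, ?_⟩
  · have := hdir p hp A hA (1, 0, 0)
    simpa [xi_one] using this
  · have := hdir p hp A hA τ
    rwa [hτ] at this

lemma c1_add (p q : HC) : c1 (p + q) = c1 p + c1 q := by simp [c1]; ring
lemma c2_add (p q : HC) : c2 (p + q) = c2 p + c2 q := by simp [c2]; ring
lemma c3_add (p q : HC) : c3 (p + q) = c3 p + c3 q := by simp [c3]; ring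
lemma c4_add (p q : HC) : c4 (p + q) = c4 p + c4 q := by simp [c4]; ring
lemma c1_sub (p q : HC) : c1 (p - q) = c1 p - c1 q := by simp [c1]; ring
lemma c2_sub (p q : HC) : c2 (p - q) = c2 p - c2 q := by simp [c2]; ring
lemma c3_sub (p q : HC) : c3 (p - q) = c3 p - c3 q := by simp [c3]; ring
lemma c4_sub (p q : HC) : c4 (p - q) = c4 p - c4 q := by simp [c4]; ring
lemma c1_smul (x : ℂ) (q : HC) : c1 (x • q) = x * c1 q := by simp [c1]; ring
lemma c2_smul (x : ℂ) (q : HC) : c2 (x • q) = x * c2 q := by simp [c2]; ring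
lemma c3_smul (x : ℂ) (q : HC) : c3 (x • q) = x * c3 q := by simp [c3]; ring
lemma c4_smul (x : ℂ) (q : HC) : c4 (x • q) = x * c4 q := by simp [c4]; ring

lemma c_e1 : c1 e1 = 1 ∧ c2 e1 = 0 ∧ c3 e1 = 0 ∧ c4 e1 = 0 := by
  refine ⟨?_, ?_, ?_, ?_⟩ <;> simp only [c1, c2, c3, c4, e1]
  · linear_combination (-1/2) * Complex.I_mul_I
  · linear_combination (1/2) * Complex.I_mul_I
  · ring
  · ring
lemma c_e2 : c1 e2 = 0 ∧ c2 e2 = 1 ∧ c3 e2 = 0 ∧ c4 e2 = 0 := by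
  refine ⟨?_, ?_, ?_, ?_⟩ <;> simp only [c1, c2, c3, c4, e2]
  · linear_combination (1/2) * Complex.I_mul_I
  · linear_combination (-1/2) * Complex.I_mul_I
  · ring
  · ring
lemma c_e3 : c1 e3 = 0 ∧ c2 e3 = 0 ∧ c3 e3 = 1 ∧ c4 e3 = 0 := by
  refine ⟨?_, ?_, ?_, ?_⟩ <;> simp only [c1, c2, c3, c4, e3]
  · ring
  · ring
  · linear_combination (-1/2) * Complex.I_mul_I
  · linear_combination (-1/2) * Complex.I_mul_I
lemma c_e4 : c1 e4 = 0 ∧ c2 e4 = 0 ∧ c3 e4 = 0 ∧ c4 e4 = 1 := by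
  refine ⟨?_, ?_, ?_, ?_⟩ <;> simp only [c1, c2, c3, c4, e4]
  · ring
  · ring
  · linear_combination (-1/2) * Complex.I_mul_I
  · linear_combination (-1/2) * Complex.I_mul_I
lemma c_one : c1 1 = 1 ∧ c2 1 = 1 ∧ c3 1 = 0 ∧ c4 1 = 0 := by
  refine ⟨?_, ?_, ?_, ?_⟩ <;> simp [c1, c2, c3, c4]

lemma HC_ext {p q : HC} (h1 : c1 p = c1 q) (h2 : c2 p = c2 q) (h3 : c3 p = c3 q)
    (h4 : c4 p = c4 q) : p = q := by
  simp only [c1, c2, c3, c4] at h1 h2 h3 h4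
  apply QuaternionAlgebra.ext
  · linear_combination (1/2) * h1 + (1/2) * h2
  · linear_combination (Complex.I/2) * h1 - (Complex.I/2) * h2 +
      (p.imI - q.imI) * Complex.I_mul_I
  · linear_combination (Complex.I/2) * h3 + (Complex.I/2) * h4 +
      (p.imJ - q.imJ) * Complex.I_mul_I
  · linear_combination (1/2) * h4 - (1/2) * h3

lemma c_form (x y z w : ℂ) :
    c1 (x • e1 + y • e2 + z • e3 + w • e4) = x ∧ c2 (x • e1 + y • e2 + z • e3 + w • e4) = y ∧
    c3 (x • e1 + y • e2 + z • e3 + w • e4) = z ∧ c4 (x • e1 + y • e2 + z • e3 + w • e4) = w := by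
  simp [c1_add, c2_add, c3_add, c4_add, c1_smul, c2_smul, c3_smul, c4_smul, c_e1, c_e2, c_e3, c_e4]

lemma c_mul_right (h q : HC) (h3 : c3 h = 0) (h4 : c4 h = 0) :
    c1 (h * q) = c1 h * c1 q ∧ c2 (h * q) = c2 h * c2 q ∧
    c3 (h * q) = c1 h * c3 q ∧ c4 (h * q) = c2 h * c4 q := by
  have hj : h.imJ = 0 := by
    simp only [c3, c4] at h3 h4
    linear_combination (Complex.I/2) * h3 + (Complex.I/2) * h4 + h.imJ * Complex.I_mul_I
  have hk : h.imK = 0 := by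
    simp only [c3, c4] at h3 h4
    linear_combination (1/2) * h4 - (1/2) * h3
  refine ⟨?_, ?_, ?_, ?_⟩ <;> simp [c1, c2, c3, c4, hj, hk] <;> ring_nf <;>
    simp only [Complex.I_sq] <;> ring

lemma c_mul_left (h q : HC) (h3 : c3 h = 0) (h4 : c4 h = 0) :
    c1 (q * h) = c1 h * c1 q ∧ c2 (q * h) = c2 h * c2 q ∧
    c3 (q * h) = c2 h * c3 q ∧ c4 (q * h) = c1 h * c4 q := by
  have hj : h.imJ = 0 := by
    simp only [c3, c4] at h3 h4
    linear_combination (Complex.I/2) * h3 + (Complex.I/2) * h4 + h.imJ * Complex.I_mul_I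
  have hk : h.imK = 0 := by
    simp only [c3, c4] at h3 h4
    linear_combination (1/2) * h4 - (1/2) * h3
  refine ⟨?_, ?_, ?_, ?_⟩ <;> simp [c1, c2, c3, c4, hj, hk] <;> ring_nf <;>
    simp only [Complex.I_sq] <;> ring

lemma c_zeta (a₁ a₂ b₁ b₂ : ℂ) (p : ℝ × ℝ × ℝ) :
    c1 (zeta (a₁ • e1 + a₂ • e2) (b₁ • e1 + b₂ • e2) p) = xi a₁ b₁ p ∧
    c2 (zeta (a₁ • e1 + a₂ • e2) (b₁ • e1 + b₂ • e2) p) = xi a₂ b₂ p ∧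
    c3 (zeta (a₁ • e1 + a₂ • e2) (b₁ • e1 + b₂ • e2) p) = 0 ∧
    c4 (zeta (a₁ • e1 + a₂ • e2) (b₁ • e1 + b₂ • e2) p) = 0 := by
  simp [zeta, xi, c1_add, c2_add, c3_add, c4_add, c1_smul, c2_smul, c3_smul, c4_smul, c_e1, c_e2,
    c_one, -Complex.coe_smul]

lemma zeta_add_smul (i2 i3 : HC) (p h : ℝ × ℝ × ℝ) (t : ℝ) :
    zeta i2 i3 p + (t : ℂ) • zeta i2 i3 h = zeta i2 i3 (p + t • h) := by
  simp only [zeta, Prod.fst_add, Prod.snd_add, Prod.smul_fst, Prod.smul_snd, smul_eq_mul,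
    Complex.ofReal_add, Complex.ofReal_mul, add_smul, smul_add, mul_smul]
  abel

lemma HC_continuous_coords : Continuous (fun q : HC => (q.re, q.imI, q.imJ, q.imK)) :=
  continuous_induced_dom

lemma continuous_c1 : Continuous c1 := by
  have h := HC_continuous_coords
  exact h.fst.sub (continuous_const.mul h.snd.fst)
lemma continuous_c2 : Continuous c2 := by
  have h := HC_continuous_coords
  exact h.fst.add (continuous_const.mul h.snd.fst)
lemma continuous_c3 : Continuous c3 := by
  have h := HC_continuous_coords
  exact (continuous_const.mul h.snd.snd.fst).neg.sub h.snd.snd.snd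
lemma continuous_c4 : Continuous c4 := by
  have h := HC_continuous_coords
  exact (continuous_const.mul h.snd.snd.fst).neg.add h.snd.snd.snd

lemma tendsto_HC {α : Type*} {l : Filter α} {f : α → HC} {q : HC}
    (h1 : Tendsto (fun x => c1 (f x)) l (𝓝 (c1 q))) (h2 : Tendsto (fun x => c2 (f x)) l (𝓝 (c2 q)))
    (h3 : Tendsto (fun x => c3 (f x)) l (𝓝 (c3 q)))
    (h4 : Tendsto (fun x => c4 (f x)) l (𝓝 (c4 q))) : Tendsto f l (𝓝 q) := by
  rw [nhds_induced, tendsto_comap_iff]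
  have e1' : ∀ q : HC, q.re = (1/2) * c1 q + (1/2) * c2 q := fun q => by
    simp only [c1, c2]; ring
  have e2' : ∀ q : HC, q.imI = (Complex.I/2) * c1 q - (Complex.I/2) * c2 q := fun q => by
    simp only [c1, c2]; linear_combination q.imI * Complex.I_mul_I
  have e3' : ∀ q : HC, q.imJ = (Complex.I/2) * c3 q + (Complex.I/2) * c4 q := fun q => by
    simp only [c3, c4]; linear_combination q.imJ * Complex.I_mul_I
  have e4' : ∀ q : HC, q.imK = (1/2) * c4 q - (1/2) * c3 q := fun q => by
    simp only [c3, c4]; ring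
  refine Tendsto.prodMk_nhds ?_ (Tendsto.prodMk_nhds ?_ (Tendsto.prodMk_nhds ?_ ?_))
  · simp only [e1']
    exact (h1.const_mul _).add (h2.const_mul _)
  · simp only [e2']
    exact (h1.const_mul _).sub (h2.const_mul _)
  · simp only [e3']
    exact (h3.const_mul _).add (h4.const_mul _)
  · simp only [e4']
    exact (h4.const_mul _).sub (h3.const_mul _)

lemma continuous_xi (a b : ℂ) : Continuous (xi a b) := by
  unfold xi
  fun_prop

lemma continuous_zeta (a₁ a₂ b₁ b₂ : ℂ) :
    Continuous (zeta (a₁ • e1 + a₂ • e2) (b₁ • e1 + b₂ • e2)) := by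
  rw [continuous_iff_continuousAt]
  intro p
  apply tendsto_HC
  · simp only [c_zeta]; exact (continuous_xi _ _).tendsto p
  · simp only [c_zeta]; exact (continuous_xi _ _).tendsto p
  · simp only [c_zeta]; exact tendsto_const_nhds
  · simp only [c_zeta]; exact tendsto_const_nhds

lemma slope_of_analytic (F : ℂ → ℂ) (w η : ℂ) (hF : AnalyticAt ℂ F w) :
    Tendsto (fun ε : ℝ => (ε : ℂ)⁻¹ * (F (w + ε * η) - F w)) (𝓝[>] 0) (𝓝 (η * deriv F w)) := by
  have h1 : HasDerivAt (fun t : ℝ => w + (t : ℂ) * η) η 0 := by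
    have := ((Complex.ofRealCLM.hasDerivAt (x := (0 : ℝ))).mul_const η).const_add w
    simpa using this
  have h2 : HasDerivAt F (deriv F w) (w + ((0 : ℝ) : ℂ) * η) := by
    simpa using hF.differentiableAt.hasDerivAt
  have h3 := (h2.comp_of_eq (0 : ℝ) h1 rfl).tendsto_slope_zero_right
  rw [mul_comm]
  refine h3.congr fun ε => ?_
  simp

lemma no_common (a₁ a₂ b₁ b₂ A B : ℂ)
    (hLI : LinIndep (a₁ • e1 + a₂ • e2) (b₁ • e1 + b₂ • e2))
    (h : ∀ p : ℝ × ℝ × ℝ, xi a₁ b₁ p * A = xi a₂ b₂ p * B) : A = 0 := by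
  by_contra hA
  have h1 := h (1, 0, 0)
  simp only [xi_one, one_mul] at h1
  subst h1
  have h2 : a₁ = a₂ := by
    have := mul_right_cancel₀ hA (h (0, 1, 0))
    simpa [xi] using this
  have h3 : b₁ = b₂ := by
    have := mul_right_cancel₀ hA (h (0, 0, 1))
    simpa [xi] using this
  subst h2 h3
  have key : ∀ x y z : ℝ, (x : ℂ) + y * a₁ + z * b₁ = 0 → x = 0 ∧ y = 0 ∧ z = 0 := by
    intro x y z hxyz
    have hz := c_zeta a₁ a₁ b₁ b₁ (x, y, z)
    apply hLI x y z
    have h0 : xi a₁ b₁ (x, y, z) = 0 := hxyz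
    rw [h0] at hz
    apply HC_ext
    · exact hz.1.trans (by simp [c1])
    · exact hz.2.1.trans (by simp [c2])
    · exact hz.2.2.1.trans (by simp [c3])
    · exact hz.2.2.2.trans (by simp [c4])
  by_cases ha : a₁.im = 0
  · have := key (-a₁.re) 1 0 (Complex.ext (by simp) (by simp [ha]))
    exact one_ne_zero this.2.1
  · have := key (b₁.im * a₁.re - b₁.re * a₁.im) (-b₁.im) a₁.im
      (Complex.ext (by simp; ring) (by simp; ring))
    exact ha this.2.2

/-- Coordinates of a right-G-monogenic map. -/
lemma right_coords (a₁ a₂ b₁ b₂ : ℂ) (Ω : Set (ℝ × ℝ × ℝ)) (Ψ : HC → HC)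
    (hR : RightGMonogenic (a₁ • e1 + a₂ • e2) (b₁ • e1 + b₂ • e2) Ψ
      (zeta (a₁ • e1 + a₂ • e2) (b₁ • e1 + b₂ • e2) '' Ω)) :
    ∀ p ∈ Ω, ∃ q : HC, ∀ h : ℝ × ℝ × ℝ, ∀ Z : ℝ × ℝ × ℝ → HC,
      Z = zeta (a₁ • e1 + a₂ • e2) (b₁ • e1 + b₂ • e2) →
      Tendsto (fun ε : ℝ => (ε : ℂ)⁻¹ * (c1 (Ψ (Z (p + ε • h))) - c1 (Ψ (Z p)))) (𝓝[>] 0)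
        (𝓝 (xi a₁ b₁ h * c1 q)) ∧
      Tendsto (fun ε : ℝ => (ε : ℂ)⁻¹ * (c2 (Ψ (Z (p + ε • h))) - c2 (Ψ (Z p)))) (𝓝[>] 0)
        (𝓝 (xi a₂ b₂ h * c2 q)) ∧
      Tendsto (fun ε : ℝ => (ε : ℂ)⁻¹ * (c3 (Ψ (Z (p + ε • h))) - c3 (Ψ (Z p)))) (𝓝[>] 0)
        (𝓝 (xi a₁ b₁ h * c3 q)) ∧
      Tendsto (fun ε : ℝ => (ε : ℂ)⁻¹ * (c4 (Ψ (Z (p + ε • h))) - c4 (Ψ (Z p)))) (𝓝[>] 0)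
        (𝓝 (xi a₂ b₂ h * c4 q)) := by
  intro p hp
  obtain ⟨q, hq⟩ := hR.2 _ (mem_image_of_mem _ hp)
  refine ⟨q, ?_⟩
  rintro h Z rfl
  have ht := hq _ ⟨h, rfl⟩
  simp only [zeta_add_smul] at ht
  obtain ⟨z1, z2, z3, z4⟩ := c_zeta a₁ a₂ b₁ b₂ h
  obtain ⟨m1, m2, m3, m4⟩ := c_mul_right _ q z3 z4
  rw [z1] at m1 m3
  rw [z2] at m2 m4
  refine ⟨?_, ?_, ?_, ?_⟩
  · rw [← m1]
    refine ((continuous_c1.tendsto _).comp ht).congr fun ε => ?_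
    rw [Function.comp, c1_smul, c1_sub]
  · rw [← m2]
    refine ((continuous_c2.tendsto _).comp ht).congr fun ε => ?_
    rw [Function.comp, c2_smul, c2_sub]
  · rw [← m3]
    refine ((continuous_c3.tendsto _).comp ht).congr fun ε => ?_
    rw [Function.comp, c3_smul, c3_sub]
  · rw [← m4]
    refine ((continuous_c4.tendsto _).comp ht).congr fun ε => ?_
    rw [Function.comp, c4_smul, c4_sub]

/-- The `e3`, `e4` coordinates of a left-G-monogenic map. -/
lemma left_coords (a₁ a₂ b₁ b₂ : ℂ) (Ω : Set (ℝ × ℝ × ℝ)) (Ψ : HC → HC)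
    (hR : LeftGMonogenic (a₁ • e1 + a₂ • e2) (b₁ • e1 + b₂ • e2) Ψ
      (zeta (a₁ • e1 + a₂ • e2) (b₁ • e1 + b₂ • e2) '' Ω)) :
    ∀ p ∈ Ω, ∃ q : HC, ∀ h : ℝ × ℝ × ℝ, ∀ Z : ℝ × ℝ × ℝ → HC,
      Z = zeta (a₁ • e1 + a₂ • e2) (b₁ • e1 + b₂ • e2) →
      Tendsto (fun ε : ℝ => (ε : ℂ)⁻¹ * (c3 (Ψ (Z (p + ε • h))) - c3 (Ψ (Z p)))) (𝓝[>] 0)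
        (𝓝 (xi a₂ b₂ h * c3 q)) ∧
      Tendsto (fun ε : ℝ => (ε : ℂ)⁻¹ * (c4 (Ψ (Z (p + ε • h))) - c4 (Ψ (Z p)))) (𝓝[>] 0)
        (𝓝 (xi a₁ b₁ h * c4 q)) := by
  intro p hp
  obtain ⟨q, hq⟩ := hR.2 _ (mem_image_of_mem _ hp)
  refine ⟨q, ?_⟩
  rintro h Z rfl
  have ht := hq _ ⟨h, rfl⟩
  simp only [zeta_add_smul] at ht
  obtain ⟨z1, z2, z3, z4⟩ := c_zeta a₁ a₂ b₁ b₂ h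
  obtain ⟨-, -, m3, m4⟩ := c_mul_left _ q z3 z4
  rw [z2] at m3
  rw [z1] at m4
  refine ⟨?_, ?_⟩
  · rw [← m3]
    refine ((continuous_c3.tendsto _).comp ht).congr fun ε => ?_
    rw [Function.comp, c3_smul, c3_sub]
  · rw [← m4]
    refine ((continuous_c4.tendsto _).comp ht).congr fun ε => ?_
    rw [Function.comp, c4_smul, c4_sub]

lemma forward_dir (a₁ a₂ b₁ b₂ : ℂ)
    (hLI : LinIndep (a₁ • e1 + a₂ • e2) (b₁ • e1 + b₂ • e2))
    (Ω : Set (ℝ × ℝ × ℝ)) (hΩo : IsOpen Ω) (hΩc : IsConnected Ω)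
    (hconv1 : ConvexInDirection Ω (lineL a₁ b₁)) (hconv2 : ConvexInDirection Ω (lineL a₂ b₂))
    (hab1 : a₁ ∉ Set.range ((↑) : ℝ → ℂ) ∨ b₁ ∉ Set.range ((↑) : ℝ → ℂ))
    (hab2 : a₂ ∉ Set.range ((↑) : ℝ → ℂ) ∨ b₂ ∉ Set.range ((↑) : ℝ → ℂ))
    (Ψ : HC → HC) (Z : ℝ × ℝ × ℝ → HC)
    (hZ : Z = zeta (a₁ • e1 + a₂ • e2) (b₁ • e1 + b₂ • e2))
    (hR : RightGMonogenic (a₁ • e1 + a₂ • e2) (b₁ • e1 + b₂ • e2) Ψ (Z '' Ω))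
    (hL : LeftGMonogenic (a₁ • e1 + a₂ • e2) (b₁ • e1 + b₂ • e2) Ψ (Z '' Ω)) :
    ∃ (F1 F2 : ℂ → ℂ) (k3 k4 : ℂ),
        AnalyticOnNhd ℂ F1 (xi a₁ b₁ '' Ω) ∧ AnalyticOnNhd ℂ F2 (xi a₂ b₂ '' Ω) ∧
        ∀ p ∈ Ω, Ψ (Z p) =
          F1 (xi a₁ b₁ p) • e1 + F2 (xi a₂ b₂ p) • e2 + k3 • e3 + k4 • e4 := by
  have hR' := right_coords a₁ a₂ b₁ b₂ Ω Ψ (by rwa [hZ] at hR)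
  have hL' := left_coords a₁ a₂ b₁ b₂ Ω Ψ (by rwa [hZ] at hL)
  have hcont : ContinuousOn (fun p => Ψ (Z p)) Ω :=
    hR.1.comp (by rw [hZ]; exact (continuous_zeta a₁ a₂ b₁ b₂).continuousOn)
      (fun p hp => mem_image_of_mem _ hp)
  obtain ⟨F1, hF1, hF1'⟩ := analytic_form a₁ b₁ hab1 Ω hΩo hconv1 (fun p => c1 (Ψ (Z p)))
    (continuous_c1.comp_continuousOn hcont) (fun p hp => by
      obtain ⟨q, hq⟩ := hR' p hp
      exact ⟨c1 q, fun h => (hq h Z hZ).1⟩)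
  obtain ⟨F2, hF2, hF2'⟩ := analytic_form a₂ b₂ hab2 Ω hΩo hconv2 (fun p => c2 (Ψ (Z p)))
    (continuous_c2.comp_continuousOn hcont) (fun p hp => by
      obtain ⟨q, hq⟩ := hR' p hp
      exact ⟨c2 q, fun h => (hq h Z hZ).2.1⟩)
  have h3 := const_of_zero (fun p => c3 (Ψ (Z p))) Ω hΩo hΩc.isPreconnected
    (continuous_c3.comp_continuousOn hcont) (fun p hp h => by
      obtain ⟨q, hq⟩ := hR' p hp
      obtain ⟨q', hq'⟩ := hL' p hp
      have h0 : c3 q = 0 := no_common a₁ a₂ b₁ b₂ _ (c3 q') hLI fun h =>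
        tendsto_nhds_unique (hq h Z hZ).2.2.1 (hq' h Z hZ).1
      have := (hq h Z hZ).2.2.1
      rwa [h0, mul_zero] at this)
  have h4 := const_of_zero (fun p => c4 (Ψ (Z p))) Ω hΩo hΩc.isPreconnected
    (continuous_c4.comp_continuousOn hcont) (fun p hp h => by
      obtain ⟨q, hq⟩ := hR' p hp
      obtain ⟨q', hq'⟩ := hL' p hp
      have h0 : c4 q' = 0 := no_common a₁ a₂ b₁ b₂ _ (c4 q) hLI fun h =>
        tendsto_nhds_unique (hq' h Z hZ).2 (hq h Z hZ).2.2.2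
      have := (hq' h Z hZ).2
      rwa [h0, mul_zero] at this)
  obtain ⟨p₀, hp₀⟩ := hΩc.nonempty
  refine ⟨F1, F2, c3 (Ψ (Z p₀)), c4 (Ψ (Z p₀)), hF1, hF2, fun p hp => ?_⟩
  obtain ⟨k1, k2, k3, k4⟩ := c_form (F1 (xi a₁ b₁ p)) (F2 (xi a₂ b₂ p)) (c3 (Ψ (Z p₀)))
    (c4 (Ψ (Z p₀)))
  apply HC_ext
  · rw [k1]; exact hF1' p hp
  · rw [k2]; exact hF2' p hp
  · rw [k3]; exact h3 p hp p₀ hp₀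
  · rw [k4]; exact h4 p hp p₀ hp₀

lemma f_zeta (a₁ a₂ b₁ b₂ : ℂ) (p : ℝ × ℝ × ℝ) :
    f1 (zeta (a₁ • e1 + a₂ • e2) (b₁ • e1 + b₂ • e2) p) = xi a₁ b₁ p ∧
    f2 (zeta (a₁ • e1 + a₂ • e2) (b₁ • e1 + b₂ • e2) p) = xi a₂ b₂ p := by
  simp [f1, f2, c_zeta]

lemma image_f (a₁ a₂ b₁ b₂ : ℂ) (Ω : Set (ℝ × ℝ × ℝ)) :
    f1 '' (zeta (a₁ • e1 + a₂ • e2) (b₁ • e1 + b₂ • e2) '' Ω) = xi a₁ b₁ '' Ω ∧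
    f2 '' (zeta (a₁ • e1 + a₂ • e2) (b₁ • e1 + b₂ • e2) '' Ω) = xi a₂ b₂ '' Ω := by
  simp only [image_image, f_zeta, and_self]

lemma backward_dir (a₁ a₂ b₁ b₂ : ℂ) (Ω : Set (ℝ × ℝ × ℝ)) (hΩo : IsOpen Ω)
    (Ψ : HC → HC) (Z : ℝ × ℝ × ℝ → HC)
    (hZ : Z = zeta (a₁ • e1 + a₂ • e2) (b₁ • e1 + b₂ • e2))
    (F1 F2 : ℂ → ℂ) (k3 k4 : ℂ) (hF1 : AnalyticOnNhd ℂ F1 (xi a₁ b₁ '' Ω))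
    (hF2 : AnalyticOnNhd ℂ F2 (xi a₂ b₂ '' Ω))
    (hform : ∀ p ∈ Ω, Ψ (Z p) =
          F1 (xi a₁ b₁ p) • e1 + F2 (xi a₂ b₂ p) • e2 + k3 • e3 + k4 • e4) :
    RightGMonogenic (a₁ • e1 + a₂ • e2) (b₁ • e1 + b₂ • e2) Ψ (Z '' Ω) ∧
    LeftGMonogenic (a₁ • e1 + a₂ • e2) (b₁ • e1 + b₂ • e2) Ψ (Z '' Ω) := by
  have hcz : ∀ p, c1 (Z p) = xi a₁ b₁ p ∧ c2 (Z p) = xi a₂ b₂ p ∧ c3 (Z p) = 0 ∧ c4 (Z p) = 0 := by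
    intro p; rw [hZ]; exact c_zeta a₁ a₂ b₁ b₂ p
  have hcΨ : ∀ p ∈ Ω, c1 (Ψ (Z p)) = F1 (xi a₁ b₁ p) ∧ c2 (Ψ (Z p)) = F2 (xi a₂ b₂ p) ∧
      c3 (Ψ (Z p)) = k3 ∧ c4 (Ψ (Z p)) = k4 := by
    intro p hp
    rw [hform p hp]
    exact c_form _ _ _ _
  have hcont : ContinuousOn Ψ (Z '' Ω) := by
    have g1 : ContinuousOn (fun ζ => F1 (c1 ζ)) (Z '' Ω) := by
      apply hF1.continuousOn.comp continuous_c1.continuousOn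
      rintro _ ⟨p, hp, rfl⟩
      exact ⟨p, hp, (hcz p).1.symm⟩
    have g2 : ContinuousOn (fun ζ => F2 (c2 ζ)) (Z '' Ω) := by
      apply hF2.continuousOn.comp continuous_c2.continuousOn
      rintro _ ⟨p, hp, rfl⟩
      exact ⟨p, hp, (hcz p).2.1.symm⟩
    have g : ContinuousOn (fun ζ : HC => F1 (c1 ζ) • e1 + F2 (c2 ζ) • e2 + k3 • e3 + k4 • e4)
        (Z '' Ω) := by
      intro ζ hζ
      apply tendsto_HC
      · simp only [c_form]; exact g1 ζ hζ
      · simp only [c_form]; exact g2 ζ hζ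
      · simp only [c_form]; exact tendsto_const_nhds
      · simp only [c_form]; exact tendsto_const_nhds
    refine g.congr ?_
    rintro _ ⟨p, hp, rfl⟩
    simp only [(hcz p).1, (hcz p).2.1]
    exact hform p hp
  have hder : ∀ p ∈ Ω, ∀ h : ℝ × ℝ × ℝ, ∀ q : HC,
      c1 q = xi a₁ b₁ h * deriv F1 (xi a₁ b₁ p) → c2 q = xi a₂ b₂ h * deriv F2 (xi a₂ b₂ p) →
      c3 q = 0 → c4 q = 0 →
      Tendsto (fun ε : ℝ => ((ε : ℂ))⁻¹ • (Ψ (Z p + (ε : ℂ) • Z h) - Ψ (Z p)))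
        (nhdsWithin 0 (Set.Ioi 0)) (nhds q) := by
    intro p hp h q q1 q2 q3 q4
    have hs : ∀ ε : ℝ, Z p + (ε : ℂ) • Z h = Z (p + ε • h) := by
      intro ε; rw [hZ]; exact zeta_add_smul _ _ _ _ _
    have hev : ∀ᶠ ε : ℝ in 𝓝[>] 0, p + ε • h ∈ Ω := by
      have hc : Continuous (fun t : ℝ => p + t • h) := by fun_prop
      have h0 := hc.tendsto 0
      rw [zero_smul, add_zero] at h0
      exact (h0.eventually (hΩo.mem_nhds hp)).filter_mono nhdsWithin_le_nhds
    simp only [hs]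
    apply tendsto_HC
    · rw [q1]
      refine (slope_of_analytic F1 _ _ (hF1 _ (mem_image_of_mem _ hp))).congr' ?_
      filter_upwards [hev] with ε hε
      rw [c1_smul, c1_sub, (hcΨ _ hε).1, (hcΨ _ hp).1, xi_add, xi_smul]
    · rw [q2]
      refine (slope_of_analytic F2 _ _ (hF2 _ (mem_image_of_mem _ hp))).congr' ?_
      filter_upwards [hev] with ε hε
      rw [c2_smul, c2_sub, (hcΨ _ hε).2.1, (hcΨ _ hp).2.1, xi_add, xi_smul]
    · rw [q3]
      refine tendsto_const_nhds.congr' ?_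
      filter_upwards [hev] with ε hε
      rw [c3_smul, c3_sub, (hcΨ _ hε).2.2.1, (hcΨ _ hp).2.2.1, sub_self, mul_zero]
    · rw [q4]
      refine tendsto_const_nhds.congr' ?_
      filter_upwards [hev] with ε hε
      rw [c4_smul, c4_sub, (hcΨ _ hε).2.2.2, (hcΨ _ hp).2.2.2, sub_self, mul_zero]
  have hq : ∀ p, ∃ q : HC, c1 q = deriv F1 (xi a₁ b₁ p) ∧ c2 q = deriv F2 (xi a₂ b₂ p) ∧
      c3 q = 0 ∧ c4 q = 0 := fun p => ⟨_, c_form _ _ _ _⟩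
  refine ⟨⟨hcont, ?_⟩, ⟨hcont, ?_⟩⟩
  · rintro _ ⟨p, hp, rfl⟩
    obtain ⟨q, q1, q2, q3, q4⟩ := hq p
    refine ⟨q, ?_⟩
    rintro _ ⟨h, rfl⟩
    rw [← hZ]
    obtain ⟨z1, z2, z3, z4⟩ := hcz h
    obtain ⟨m1, m2, m3, m4⟩ := c_mul_right (Z h) q z3 z4
    apply hder p hp
    · rw [m1, z1, q1]
    · rw [m2, z2, q2]
    · rw [m3, q3, mul_zero]
    · rw [m4, q4, mul_zero]
  · rintro _ ⟨p, hp, rfl⟩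
    obtain ⟨q, q1, q2, q3, q4⟩ := hq p
    refine ⟨q, ?_⟩
    rintro _ ⟨h, rfl⟩
    rw [← hZ]
    obtain ⟨z1, z2, z3, z4⟩ := hcz h
    obtain ⟨m1, m2, m3, m4⟩ := c_mul_left (Z h) q z3 z4
    apply hder p hp
    · rw [m1, z1, q1]
    · rw [m2, z2, q2]
    · rw [m3, q3, mul_zero]
    · rw [m4, q4, mul_zero]

/-- a map `Ψ` is simultaneously right- and left-G-monogenic in `Ω_ζ` iff it has the
form `Ψ(ζ) = F₁(ξ₁)e₁ + F₂(ξ₂)e₂ + c₃e₃ + c₄e₄` with `F₁` analytic on `D₁`, `F₂` analytic on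
`D₂`, and constants `c₃, c₄ ∈ ℂ`. -/
theorem statement15 (a₁ a₂ b₁ b₂ : ℂ) (i2 i3 : HC)
    (hi2 : i2 = a₁ • e1 + a₂ • e2) (hi3 : i3 = b₁ • e1 + b₂ • e2)
    (hLI : LinIndep i2 i3)
    (Ω : Set (ℝ × ℝ × ℝ)) (hΩo : IsOpen Ω) (hΩc : IsConnected Ω)
    (hconv1 : ConvexInDirection Ω (lineL a₁ b₁)) (hconv2 : ConvexInDirection Ω (lineL a₂ b₂))
    (hab1 : a₁ ∉ Set.range ((↑) : ℝ → ℂ) ∨ b₁ ∉ Set.range ((↑) : ℝ → ℂ))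
    (hab2 : a₂ ∉ Set.range ((↑) : ℝ → ℂ) ∨ b₂ ∉ Set.range ((↑) : ℝ → ℂ))
    (Ψ : HC → HC) :
    (RightGMonogenic i2 i3 Ψ (zeta i2 i3 '' Ω) ∧
        LeftGMonogenic i2 i3 Ψ (zeta i2 i3 '' Ω)) ↔
      ∃ (F1 F2 : ℂ → ℂ) (c3 c4 : ℂ),
        AnalyticOnNhd ℂ F1 (f1 '' (zeta i2 i3 '' Ω)) ∧
        AnalyticOnNhd ℂ F2 (f2 '' (zeta i2 i3 '' Ω)) ∧
        ∀ p ∈ Ω, Ψ (zeta i2 i3 p) =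
          F1 (xi a₁ b₁ p) • e1 + F2 (xi a₂ b₂ p) • e2 + c3 • e3 + c4 • e4 := by
  subst hi2 hi3
  rw [(image_f a₁ a₂ b₁ b₂ Ω).1, (image_f a₁ a₂ b₁ b₂ Ω).2]
  constructor
  · rintro ⟨hR, hL⟩
    exact forward_dir a₁ a₂ b₁ b₂ hLI Ω hΩo hΩc hconv1 hconv2 hab1 hab2 Ψ _ rfl hR hL
  · rintro ⟨F1, F2, k3, k4, hF1, hF2, hform⟩
    exact backward_dir a₁ a₂ b₁ b₂ Ω hΩo Ψ _ rfl F1 F2 k3 k4 hF1 hF2 hform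

end
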